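/- Let F be a layered 3-graph with layered function f. Then π_⸫(F) = 0 if and only if π_⸫(F_{i,j}) = 0 for every linked pair {i,j}. -/

import Mathlib

open Finset

structure ThreeGraph (V : Type*) where
  edges : Finset (Finset V)
  card_eq : ∀ e ∈ edges, e.card = 3

variable {α β : Type*}

/-- `H` contains a copy of `F`. -/
def HasCopy [DecidableEq β] (H : ThreeGraph β) (F : ThreeGraph α) : Prop :=
  ∃ φ : α → β, Function.Injective φ ∧ ∀ e ∈ F.edges, e.image φ ∈ H.edges

/-- The codegree of a pair of vertices. -/
def codeg [DecidableEq β] [Fintype β] (H : ThreeGraph β) (u v : β) : ℕ :=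
  (Finset.univ.filter (fun w => ({u, v, w} : Finset β) ∈ H.edges)).card

/-- The codegree Turán density of a 3-graph `F`. -/
noncomputable def piCo (F : ThreeGraph α) : ℝ :=
  sSup {x : ℝ | 0 ≤ x ∧ x ≤ 1 ∧ ∀ n₀ : ℕ, ∃ n : ℕ, n₀ ≤ n ∧ ∃ H : ThreeGraph (Fin n),
    ¬ HasCopy H F ∧ ∀ u v : Fin n, u ≠ v → x * n ≤ (codeg H u v : ℝ)}

/-- An `n`-vertex 3-graph is uniformly `(d, η)`-dense. -/
def UniformlyDense {n : ℕ} (H : ThreeGraph (Fin n)) (d η : ℝ) : Prop :=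
  ∀ U : Finset (Fin n),
    d * (U.card.choose 3 : ℝ) - η * (n : ℝ) ^ 3 ≤ ((H.edges.filter (fun e => e ⊆ U)).card : ℝ)

/-- The uniform Turán density of a 3-graph `F`. -/
noncomputable def piUnif (F : ThreeGraph α) : ℝ :=
  sSup {d : ℝ | 0 ≤ d ∧ d ≤ 1 ∧ ∀ η : ℝ, 0 < η → ∀ n₀ : ℕ, ∃ n : ℕ, n₀ ≤ n ∧
    ∃ H : ThreeGraph (Fin n), ¬ HasCopy H F ∧ UniformlyDense H d η}

/-- `f` is a layered function of the 3-graph with edge set `E`. -/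
def IsLayeredFunction [DecidableEq α] (E : Finset (Finset α)) (f : α → ℕ) : Prop :=
  (∀ e ∈ E, ∃ w ∈ e, ∀ u ∈ e, u ≠ w → f u < f w) ∧
  (∀ e₁ ∈ E, ∀ e₂ ∈ E, e₁.sup f = e₂.sup f → Multiset.map f e₁.val = Multiset.map f e₂.val) ∧
  (∀ e₁ ∈ E, ∀ e₂ ∈ E, ∀ u v w u' v' w' : α,
    u ≠ v → u ≠ w → v ≠ w → u' ≠ v' → u' ≠ w' → v' ≠ w' →
    e₁ = {u, v, w} → e₂ = {u', v', w'} →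
    f u = f u' → f v = f v' → f w = f w')

/-- A 3-graph is layered if it admits a layered function. -/
def IsLayered [DecidableEq α] (F : ThreeGraph α) : Prop :=
  ∃ f : α → ℕ, IsLayeredFunction F.edges f

/-- The subhypergraph of `F` induced on a set `S` of vertices. -/
def ThreeGraph.induce [DecidableEq α] (F : ThreeGraph α) (S : Finset α) :
    ThreeGraph {x : α // x ∈ S} where
  edges := (F.edges.filter (fun e => e ⊆ S)).image (fun e => e.subtype (fun x => x ∈ S))
  card_eq := by
    intro e he
    obtain ⟨e', he', rfl⟩ := Finset.mem_image.mp he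
    obtain ⟨h1, h2⟩ := Finset.mem_filter.mp he'
    rw [Finset.card_subtype, Finset.filter_true_of_mem (fun x hx => h2 hx)]
    exact F.card_eq e' h1

open scoped BigOperators

/-- The proportion of the elements of `Ω` that satisfy `Y`. -/
noncomputable def prob {T : Type*} (Ω : Finset T) (Y : T → Prop) : ℝ :=
  open Classical in 𝔼 ω ∈ Ω, if Y ω then (1 : ℝ) else 0

theorem prob_mono {T : Type*} {Ω : Finset T} {Y Z : T → Prop} (h : ∀ ω ∈ Ω, Y ω → Z ω) :
    prob Ω Y ≤ prob Ω Z := by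
  classical
  refine expect_le_expect fun ω hω => ?_
  by_cases h1 : Y ω
  · simp [h1, h ω hω h1]
  · simp only [h1, if_false]
    split_ifs <;> norm_num

theorem prob_congr {T : Type*} {Ω : Finset T} {Y Z : T → Prop} (h : ∀ ω ∈ Ω, (Y ω ↔ Z ω)) :
    prob Ω Y = prob Ω Z :=
  le_antisymm (prob_mono fun ω hω => (h ω hω).1) (prob_mono fun ω hω => (h ω hω).2)

theorem prob_le_sum {T κ : Type*} {Ω : Finset T} {Y : T → Prop} (J : Finset κ)
    (Z : κ → T → Prop) (h : ∀ ω ∈ Ω, Y ω → ∃ k ∈ J, Z k ω) :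
    prob Ω Y ≤ ∑ k ∈ J, prob Ω (Z k) := by
  classical
  unfold prob
  rw [← expect_sum_comm]
  refine expect_le_expect fun ω hω => ?_
  by_cases h1 : Y ω
  · obtain ⟨k, hk, hz⟩ := h ω hω h1
    have := single_le_sum (f := fun k => if Z k ω then (1 : ℝ) else 0)
      (fun k _ => by split_ifs <;> norm_num) hk
    simpa [h1, hz] using this
  · simp only [h1, if_false]
    exact sum_nonneg fun k _ => by split_ifs <;> norm_num

/-- If sufficiently many events each have probability at least `c`, then some `r` of them occur
simultaneously with probability bounded away from `0`. -/
theorem exists_large_inter (r : ℕ) {c : ℝ} (hc : 0 < c) :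
    ∃ c' : ℝ, 0 < c' ∧ ∃ K : ℕ, ∀ (κ T : Type) (Ω : Finset T) (J : Finset κ)
      (Y : κ → T → Prop), Ω.Nonempty → K ≤ #J → (∀ k ∈ J, c ≤ prob Ω (Y k)) →
      ∃ R ⊆ J, #R = r ∧ c' ≤ prob Ω fun ω => ∀ k ∈ R, Y k ω := by
  classical
  obtain ⟨N, hN⟩ := exists_nat_gt (2 * r / c)
  set K := max N (r + 1)
  have hK : 2 * (r : ℝ) < K * c := by
    rw [div_lt_iff₀ hc] at hN
    exact hN.trans_le (by gcongr; exact_mod_cast le_max_left _ _)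
  have hr : r < K := lt_of_lt_of_le (Nat.lt_succ_self r) (le_max_right _ _)
  have hK0 : (0 : ℝ) < K := by exact_mod_cast (Nat.zero_le r).trans_lt hr
  refine ⟨c / 2 / 2 ^ K, by positivity, K, ?_⟩
  intro κ T Ω J₀ Y hΩ hJ₀ hY₀
  obtain ⟨J, hJJ, hJ⟩ := exists_subset_card_eq hJ₀
  have hlow : (K : ℝ) * c ≤ ∑ k ∈ J, prob Ω (Y k) := by
    rw [← hJ, ← nsmul_eq_mul]
    exact card_nsmul_le_sum _ _ _ fun k hk => hY₀ k (hJJ hk)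
  have hup : ∑ k ∈ J, prob Ω (Y k) ≤ r + K * prob Ω fun ω => r ≤ #{k ∈ J | Y k ω} := by
    unfold prob
    rw [← expect_sum_comm, mul_expect, ← expect_const hΩ (r : ℝ), ← expect_add_distrib]
    refine expect_le_expect fun ω _ => ?_
    rw [sum_boole]
    split_ifs with h
    · have := card_filter_le J (fun k => Y k ω)
      rw [hJ] at this
      have h2 : (#{k ∈ J | Y k ω} : ℝ) ≤ K := by exact_mod_cast this
      have h3 : (0 : ℝ) ≤ r := Nat.cast_nonneg r
      linarith
    · push Not at h
      have h2 : (#{k ∈ J | Y k ω} : ℝ) ≤ r := by exact_mod_cast h.le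
      linarith
  have hB : c / 2 ≤ prob Ω fun ω => r ≤ #{k ∈ J | Y k ω} := by
    refine le_of_mul_le_mul_left ?_ hK0
    linarith
  have hcover := prob_le_sum (Ω := Ω) (powersetCard r J) (fun R ω => ∀ k ∈ R, Y k ω)
    (Y := fun ω => r ≤ #{k ∈ J | Y k ω}) (by
      intro ω _ hω
      obtain ⟨R, hR, hRc⟩ := exists_subset_card_eq hω
      exact ⟨R, mem_powersetCard.2 ⟨hR.trans (filter_subset _ _), hRc⟩,
        fun k hk => (mem_filter.1 (hR hk)).2⟩)
  by_contra! hcon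
  have hne : (powersetCard r J).Nonempty := by
    rw [powersetCard_nonempty, hJ]
    exact hr.le
  have hlt := sum_lt_sum_of_nonempty hne (f := fun R => prob Ω fun ω => ∀ k ∈ R, Y k ω)
    (g := fun _ => c / 2 / 2 ^ K) fun R hR =>
      hcon R ((mem_powersetCard.1 hR).1.trans hJJ) (mem_powersetCard.1 hR).2
  rw [sum_const, nsmul_eq_mul, card_powersetCard, hJ] at hlt
  have h4 : (K.choose r : ℝ) ≤ 2 ^ K := by exact_mod_cast Nat.choose_le_two_pow K r
  have h5 : (K.choose r : ℝ) * (c / 2 / 2 ^ K) ≤ 2 ^ K * (c / 2 / 2 ^ K) := by gcongr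
  have h6 : (2 : ℝ) ^ K * (c / 2 / 2 ^ K) = c / 2 := by field_simp
  linarith

/-- Ramsey's theorem for `k`-subsets and two colours. -/
theorem ramsey_two (k : ℕ) : ∀ a b : ℕ, ∃ N : ℕ, ∀ (ι : Type) [DecidableEq ι] (S : Finset ι)
    (good : Finset ι → Prop), N ≤ #S →
      (∃ T ⊆ S, #T = a ∧ ∀ R ⊆ T, #R = k → good R) ∨
      (∃ T ⊆ S, #T = b ∧ ∀ R ⊆ T, #R = k → ¬ good R) := by
  induction k with
  | zero =>
    intro a b
    refine ⟨max a b, fun ι _ S good hS => ?_⟩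
    by_cases h : good ∅
    · obtain ⟨T, hT, hTc⟩ := exists_subset_card_eq ((le_max_left a b).trans hS)
      exact .inl ⟨T, hT, hTc, fun R _ hR => by rwa [card_eq_zero.1 hR]⟩
    · obtain ⟨T, hT, hTc⟩ := exists_subset_card_eq ((le_max_right a b).trans hS)
      exact .inr ⟨T, hT, hTc, fun R _ hR => by rwa [card_eq_zero.1 hR]⟩
  | succ k ihk =>
    intro a
    induction a with
    | zero =>
      exact fun b => ⟨0, fun ι _ S good _ => .inl ⟨∅, empty_subset _, rfl, fun R hR hRc => by
        rw [subset_empty.1 hR] at hRc; simp at hRc⟩⟩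
    | succ a iha =>
      intro b
      induction b with
      | zero =>
        exact ⟨0, fun ι _ S good _ => .inr ⟨∅, empty_subset _, rfl, fun R hR hRc => by
          rw [subset_empty.1 hR] at hRc; simp at hRc⟩⟩
      | succ b ihb =>
        obtain ⟨A, hA⟩ := iha (b + 1)
        obtain ⟨B, hB⟩ := ihb
        obtain ⟨N, hN⟩ := ihk A B
        refine ⟨N + 1, fun ι _ S good hS => ?_⟩
        obtain ⟨v, hv⟩ : S.Nonempty := card_pos.1 (by omega)
        have extend : ∀ (g : Finset ι → Prop) (U T : Finset ι), U ⊆ S.erase v → T ⊆ U →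
            (∀ R ⊆ U, #R = k → g (insert v R)) → (∀ R ⊆ T, #R = k + 1 → g R) →
            insert v T ⊆ S ∧ #(insert v T) = #T + 1 ∧
              ∀ R ⊆ insert v T, #R = k + 1 → g R := by
          intro g U T hU hT hg hg'
          have hvT : v ∉ T := fun h => (notMem_erase v S) (hU (hT h))
          refine ⟨insert_subset hv ((hT.trans hU).trans (erase_subset _ _)),
            card_insert_of_notMem hvT, fun R hR hRc => ?_⟩
          by_cases hvR : v ∈ R
          · rw [← insert_erase hvR]
            refine hg _ ((subset_insert_iff.1 hR).trans hT) ?_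
            rw [card_erase_of_mem hvR, hRc, Nat.add_sub_cancel]
          · exact hg' R ((subset_insert_iff_of_notMem hvR).1 hR) hRc
        rcases hN ι (S.erase v) (fun R => good (insert v R))
          (by rw [card_erase_of_mem hv]; omega) with ⟨U, hU, hUc, hg⟩ | ⟨U, hU, hUc, hg⟩
        · rcases hA ι U good hUc.ge with ⟨T, hT, hTc, hgT⟩ | ⟨T, hT, hTc, hgT⟩
          · obtain ⟨h1, h2, h3⟩ := extend good U T hU hT hg hgT
            exact .inl ⟨_, h1, by rw [h2, hTc], h3⟩
          · exact .inr ⟨T, (hT.trans hU).trans (erase_subset _ _), hTc, hgT⟩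
        · rcases hB ι U good hUc.ge with ⟨T, hT, hTc, hgT⟩ | ⟨T, hT, hTc, hgT⟩
          · exact .inl ⟨T, (hT.trans hU).trans (erase_subset _ _), hTc, hgT⟩
          · obtain ⟨h1, h2, h3⟩ := extend (fun R => ¬ good R) U T hU hT hg hgT
            exact .inr ⟨_, h1, by rw [h2, hTc], h3⟩

/-- If every `m`-subset contains a good `k`-subset then large sets contain `m'`-subsets all of
whose `k`-subsets are good. -/
theorem ramsey_good (k m m' : ℕ) : ∃ N : ℕ, ∀ (ι : Type) [DecidableEq ι] (S : Finset ι)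
    (good : Finset ι → Prop), N ≤ #S →
      (∀ U ⊆ S, #U = m → ∃ R ⊆ U, #R = k ∧ good R) →
      ∃ T ⊆ S, #T = m' ∧ ∀ R ⊆ T, #R = k → good R := by
  obtain ⟨N, hN⟩ := ramsey_two k m' m
  refine ⟨N, fun ι _ S good hS h => ?_⟩
  rcases hN ι S good hS with h1 | ⟨T, hT, hTc, hb⟩
  · exact h1
  · obtain ⟨R, hR, hRc, hg⟩ := h T hT hTc
    exact absurd hg (hb R hR hRc)

/-- The version of `ramsey_good` for finitely many notions of goodness. -/
theorem ramsey_good_family (k m m' q : ℕ) : ∃ N : ℕ, ∀ (ι κ : Type) [DecidableEq ι]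
    (C : Finset κ) (S : Finset ι) (good : κ → Finset ι → Prop), #C = q → N ≤ #S →
      (∀ c ∈ C, ∀ U ⊆ S, #U = m → ∃ R ⊆ U, #R = k ∧ good c R) →
      ∃ T ⊆ S, #T = m' ∧ ∀ c ∈ C, ∀ R ⊆ T, #R = k → good c R := by
  classical
  induction q with
  | zero =>
    refine ⟨m', fun ι κ _ C S good hC hS _ => ?_⟩
    obtain ⟨T, hT, hTc⟩ := exists_subset_card_eq hS
    refine ⟨T, hT, hTc, fun c hc => ?_⟩
    rw [card_eq_zero.1 hC] at hc
    simp at hc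
  | succ q ih =>
    obtain ⟨N, hN⟩ := ih
    obtain ⟨N', hN'⟩ := ramsey_good k m N
    refine ⟨N', fun ι κ _ C S good hC hS h => ?_⟩
    obtain ⟨c, C', hc, rfl, hC'⟩ := card_eq_succ.1 hC
    obtain ⟨T, hT, hTc, hg⟩ := hN' ι S (good c) hS (h c (mem_insert_self _ _))
    obtain ⟨T', hT', hTc', hg'⟩ := hN ι κ C' T good hC' hTc.ge
      fun d hd U hU => h d (mem_insert_of_mem hd) U (hU.trans hT)
    refine ⟨T', hT'.trans hT, hTc', fun d hd R hR hRc => ?_⟩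
    rcases mem_insert.1 hd with rfl | hd
    · exact hg R (hR.trans hT') hRc
    · exact hg' d hd R hR hRc

/-- Ramsey's theorem for properties of increasing `k`-tuples. -/
theorem ramsey_tuple (k m m' q : ℕ) : ∃ N : ℕ, ∀ (ι κ : Type) [LinearOrder ι] [Fintype κ]
    (S : Finset ι) (P : κ → (Fin k → ι) → Prop), Fintype.card κ = q → N ≤ #S →
      (∀ c, ∀ U ⊆ S, #U = m → ∃ θ : Fin k → ι, StrictMono θ ∧ (∀ i, θ i ∈ U) ∧ P c θ) →
      ∃ T ⊆ S, #T = m' ∧ ∀ c, ∀ θ : Fin k → ι, StrictMono θ → (∀ i, θ i ∈ T) → P c θ := by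
  classical
  obtain ⟨N, hN⟩ := ramsey_good_family k m m' q
  refine ⟨N, fun ι κ _ _ S P hq hS h => ?_⟩
  obtain ⟨T, hT, hTc, hg⟩ := hN ι κ univ S
    (fun c R => ∀ θ : Fin k → ι, StrictMono θ → univ.image θ = R → P c θ) hq hS (by
      intro c _ U hU hUc
      obtain ⟨θ, hθ, hθU, hP⟩ := h c U hU hUc
      refine ⟨univ.image θ, by simpa [image_subset_iff] using hθU, ?_, fun θ' hθ' he => ?_⟩
      · rw [card_image_of_injective _ hθ.injective, card_univ, Fintype.card_fin]
      · have : θ' = θ := by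
          rw [← hθ'.range_inj hθ]
          simpa using congrArg (fun s : Finset ι => (s : Set ι)) he
        rwa [this])
  refine ⟨T, hT, hTc, fun c θ hθ hθT => hg c (mem_univ _) (univ.image θ) ?_ ?_ θ hθ rfl⟩
  · simpa [image_subset_iff] using hθT
  · rw [card_image_of_injective _ hθ.injective, card_univ, Fintype.card_fin]

theorem strictMono_vec_four {ι : Type*} [Preorder ι] {a b c d : ι} (hab : a < b) (hbc : b < c)
    (hcd : c < d) : StrictMono ![a, b, c, d] := by
  rw [Fin.strictMono_iff_lt_succ]
  simp [Fin.forall_fin_succ, hab, hbc, hcd]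

/-- In a sufficiently long sequence of likely events indexed by pairs there are `p` indices such
that, for each way of splitting them into tails and heads, the events from the tails to the heads
occur simultaneously with probability bounded away from `0`. -/
theorem exists_half_system (p : ℕ) : ∀ (q : ℕ) (c : ℝ), 0 < c →
    ∃ c' : ℝ, 0 < c' ∧ ∃ N : ℕ, ∀ (σ ι T : Type) [Fintype σ] [LinearOrder ι] (Ω : Finset T)
      (X : Finset ι) (Y : σ → ι → ι → T → Prop), Ω.Nonempty → Fintype.card σ = q → N ≤ #X →
      (∀ s, ∀ i ∈ X, ∀ j ∈ X, i < j → c ≤ prob Ω (Y s i j)) →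
      ∃ I ⊆ X, #I = p ∧ ∃ l ∈ X, ∃ r ∈ X, l < r ∧ (∀ i ∈ I, l < i ∧ i < r) ∧
        ∀ s, ∀ A ⊆ I, c' ≤ prob Ω fun ω =>
          ∀ a ∈ insert l A, ∀ b ∈ insert r (I \ A), a < b → Y s a b ω := by
  induction p with
  | zero =>
    intro q c hc
    refine ⟨c, hc, 2, fun σ ι T _ _ Ω X Y hΩ _ hX hY => ?_⟩
    obtain ⟨l, hl, r, hr, hlr⟩ : ∃ l ∈ X, ∃ r ∈ X, l < r := by
      obtain ⟨l, hl, r, hr, hne⟩ := one_lt_card.1 hX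
      rcases lt_or_gt_of_ne hne with h | h
      exacts [⟨l, hl, r, hr, h⟩, ⟨r, hr, l, hl, h⟩]
    refine ⟨∅, empty_subset _, rfl, l, hl, r, hr, hlr, by simp, fun s A hA => ?_⟩
    rw [subset_empty.1 hA]
    refine (hY s l hl r hr hlr).trans (prob_mono fun ω _ h => ?_)
    simpa [hlr] using h
  | succ p ih =>
    intro q c hc
    obtain ⟨c₁, hc₁, K₁, hK₁⟩ := exists_large_inter 3 hc
    obtain ⟨c₂, hc₂, K₂, hK₂⟩ := exists_large_inter 2 hc₁
    obtain ⟨c₃, hc₃, N, hN⟩ := ih (q * 2) (min c₁ c₂) (lt_min hc₁ hc₂)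
    obtain ⟨N₂, hN₂⟩ := ramsey_tuple 4 (2 + 2 * K₂) (N + 2) q
    obtain ⟨N₁, hN₁⟩ := ramsey_tuple 4 (K₁ + 1) N₂ q
    refine ⟨c₃, hc₃, N₁, fun σ ι T _ _ Ω X Y hΩ hσ hX hY => ?_⟩
    obtain ⟨X₁, hX₁, hX₁c, hA⟩ := hN₁ ι σ X (fun s θ => c₁ ≤ prob Ω fun ω =>
      Y s (θ 0) (θ 3) ω ∧ Y s (θ 1) (θ 3) ω ∧ Y s (θ 2) (θ 3) ω) hσ hX (by
      intro s U hU hUc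
      have hUne : U.Nonempty := card_pos.1 (by omega)
      obtain ⟨R, hR, hRc, hP⟩ := hK₁ ι T Ω (U.erase (U.max' hUne))
        (fun x => Y s x (U.max' hUne)) hΩ
        (by rw [card_erase_of_mem (max'_mem _ _)]; omega)
        (fun x hx => hY s x (hU (mem_of_mem_erase hx)) _ (hU (max'_mem _ _))
          (lt_max'_of_mem_erase_max' _ _ hx))
      let e := R.orderEmbOfFin hRc
      have he : ∀ i, e i ∈ R := fun i => orderEmbOfFin_mem _ _ _
      have hlast := lt_max'_of_mem_erase_max' _ _ (hR (he 2))
      refine ⟨![e 0, e 1, e 2, U.max' hUne], ?_, ?_, ?_⟩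
      · exact strictMono_vec_four (by simp) (by simp) hlast
      · have := fun i => mem_of_mem_erase (hR (he i))
        simp [Fin.forall_fin_succ, this, max'_mem]
      · exact hP.trans (prob_mono fun ω _ h => ⟨h _ (he 0), h _ (he 1), h _ (he 2)⟩))
    obtain ⟨X₂, hX₂, hX₂c, hB⟩ := hN₂ ι σ X₁ (fun s θ => c₂ ≤ prob Ω fun ω =>
      Y s (θ 0) (θ 1) ω ∧ Y s (θ 0) (θ 3) ω ∧ Y s (θ 2) (θ 3) ω) hσ hX₁c.ge (by
      intro s U hU hUc
      let e := U.orderEmbOfFin hUc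
      have he : ∀ i, e i ∈ U := fun i => orderEmbOfFin_mem _ _ _
      obtain ⟨R, -, hRc, hP⟩ := hK₂ (Fin K₂) T Ω univ
        (fun t ω => Y s (e ⟨0, by omega⟩) (e ⟨3 + 2 * t, by omega⟩) ω ∧
          Y s (e ⟨2 + 2 * t, by omega⟩) (e ⟨3 + 2 * t, by omega⟩) ω) hΩ
        (by simp)
        (fun t _ => by
          refine (hA s ![e ⟨0, by omega⟩, e ⟨1, by omega⟩, e ⟨2 + 2 * t, by omega⟩,
            e ⟨3 + 2 * t, by omega⟩] ?_ ?_).trans (prob_mono fun ω _ h => ⟨h.1, h.2.2⟩)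
          · exact strictMono_vec_four (e.strictMono (Fin.mk_lt_mk.2 (by omega)))
              (e.strictMono (Fin.mk_lt_mk.2 (by omega)))
              (e.strictMono (Fin.mk_lt_mk.2 (by omega)))
          · simp [Fin.forall_fin_succ, hU (he _)])
      let t := R.orderEmbOfFin hRc
      have htm : ∀ i, t i ∈ R := fun i => orderEmbOfFin_mem _ _ _
      have ht : t 0 < t 1 := by simp
      have ht' : (t 0 : ℕ) < t 1 := ht
      refine ⟨![e ⟨0, by omega⟩, e ⟨3 + 2 * t 0, by omega⟩, e ⟨2 + 2 * t 1, by omega⟩,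
            e ⟨3 + 2 * t 1, by omega⟩], ?_, ?_, ?_⟩
      · exact strictMono_vec_four (e.strictMono (Fin.mk_lt_mk.2 (by omega)))
          (e.strictMono (Fin.mk_lt_mk.2 (by omega)))
          (e.strictMono (Fin.mk_lt_mk.2 (by omega)))
      · simp [Fin.forall_fin_succ, he]
      · exact hP.trans (prob_mono fun ω _ h =>
          ⟨(h _ (htm 0)).1, (h _ (htm 1)).1, (h _ (htm 1)).2⟩))
    have hne : X₂.Nonempty := card_pos.1 (by omega)
    have hne' : (X₂.erase (X₂.min' hne)).Nonempty :=
      card_pos.1 (by rw [card_erase_of_mem (min'_mem _ _)]; omega)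
    obtain ⟨l', hl', i, hi, hl'i, X₃, hX₃, hX₃c, hiX⟩ : ∃ l' ∈ X₂, ∃ i ∈ X₂, l' < i ∧
        ∃ X₃ ⊆ X₂, N ≤ #X₃ ∧ ∀ x ∈ X₃, i < x := by
      refine ⟨_, min'_mem _ hne, _, mem_of_mem_erase (min'_mem _ hne'),
        min'_lt_of_mem_erase_min' _ _ (min'_mem _ hne'),
        (X₂.erase (X₂.min' hne)).erase ((X₂.erase (X₂.min' hne)).min' hne'),
        (erase_subset _ _).trans (erase_subset _ _), ?_,
        fun x hx => min'_lt_of_mem_erase_min' _ _ hx⟩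
      rw [card_erase_of_mem (min'_mem _ _), card_erase_of_mem (min'_mem _ _)]
      omega
    obtain ⟨I, hI, hIc, l, hl, r, hr, hlr, hlIr, hsys⟩ := hN (σ × Bool) ι T Ω X₃
      (fun s j k ω => if s.2 then Y s.1 l' k ω ∧ Y s.1 i k ω ∧ Y s.1 j k ω else
        Y s.1 l' i ω ∧ Y s.1 l' k ω ∧ Y s.1 j k ω) hΩ (by simp [hσ]) hX₃c (by
      rintro ⟨s, b⟩ j hj k hk hjk
      have hmono : StrictMono ![l', i, j, k] := strictMono_vec_four hl'i (hiX j hj) hjk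
      have hmem : ∀ t, ![l', i, j, k] t ∈ X₂ := by
        simp [Fin.forall_fin_succ, hl', hi, hX₃ hj, hX₃ hk]
      cases b
      · exact (min_le_right _ _).trans ((hB s _ hmono hmem).trans
          (prob_mono fun ω _ h => by simpa using h))
      · exact (min_le_left _ _).trans ((hA s _ hmono fun t => hX₂ (hmem t)).trans
          (prob_mono fun ω _ h => by simpa using h)))
    have hiI : i ∉ I := fun h => lt_irrefl _ (hiX i (hI h))
    have hsub : X₃ ⊆ X := hX₃.trans (hX₂.trans hX₁)
    refine ⟨insert i I, insert_subset (hX₁ (hX₂ hi)) (hI.trans hsub),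
      by rw [card_insert_of_notMem hiI, hIc], l', hX₁ (hX₂ hl'), r, hsub hr,
      hl'i.trans (hiX r hr), ?_, fun s A hAI => ?_⟩
    · intro x hx
      rcases mem_insert.1 hx with rfl | hx
      · exact ⟨hl'i, hiX r hr⟩
      · exact ⟨hl'i.trans (hiX x (hI hx)), (hlIr x hx).2⟩
    · by_cases hiA : i ∈ A
      · refine (hsys (s, true) (A.erase i) (subset_insert_iff.1 hAI)).trans
          (prob_mono fun ω _ h a ha b hb hab => ?_)
        simp only [if_true] at h
        have hb' : b ∈ insert r (I \ A.erase i) := by grind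
        have hlb : l < b := by
          rcases mem_insert.1 hb' with rfl | hb'
          · exact hlr
          · exact (hlIr b (mem_sdiff.1 hb').1).1
        have h1 := h l (mem_insert_self _ _) b hb' hlb
        by_cases hal : a = l'
        · rw [hal]; exact h1.1
        by_cases hai : a = i
        · rw [hai]; exact h1.2.1
        exact (h a (by grind) b hb' hab).2.2
      · have hAI' : A ⊆ I := (subset_insert_iff_of_notMem hiA).1 hAI
        refine (hsys (s, false) A hAI').trans (prob_mono fun ω _ h a ha b hb hab => ?_)
        simp only [Bool.false_eq_true, if_false] at h
        by_cases hbi : b = i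
        · have hal : a = l' := by
            rcases mem_insert.1 ha with h | h
            · exact h
            · exact absurd (hiX a (hI (hAI' h))) (by rw [← hbi]; exact hab.not_gt)
          rw [hbi, hal]
          exact (h l (mem_insert_self _ _) r (mem_insert_self _ _) hlr).1
        have hb' : b ∈ insert r (I \ A) := by grind
        have hlb : l < b := by
          rcases mem_insert.1 hb' with rfl | hb'
          · exact hlr
          · exact (hlIr b (mem_sdiff.1 hb').1).1
        by_cases hal : a = l'
        · rw [hal]; exact (h l (mem_insert_self _ _) b hb' hlb).2.1
        exact (h a (by grind) b hb' hab).2.2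

section Regular

variable {ι V : Type} [Fintype ι]

theorem prod_weight_mem {w : ι → V → ℝ} (hw : ∀ i v, 0 ≤ w i v ∧ w i v ≤ 1) (x : ι → V) :
    0 ≤ ∏ i, w i (x i) ∧ ∏ i, w i (x i) ≤ 1 :=
  ⟨prod_nonneg fun i _ => (hw i _).1, prod_le_one (fun i _ => (hw i _).1) fun i _ => (hw i _).2⟩

variable [DecidableEq ι]

/-- The function `Q` on the box `∏ i, P i` is `δ`-close to the constant `t` when tested against
products of one-variable weights. -/
def IsBoxRegular (P : ι → Finset V) (Q : (ι → V) → ℝ) (t δ : ℝ) : Prop :=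
  ∀ w : ι → V → ℝ, (∀ i v, 0 ≤ w i v ∧ w i v ≤ 1) →
    |𝔼 x ∈ Fintype.piFinset P, (Q x - t) * ∏ i, w i (x i)| ≤ δ

theorem IsBoxRegular.mean {P : ι → Finset V} {Q : (ι → V) → ℝ} {t δ : ℝ}
    (hP : ∀ i, (P i).Nonempty) (h : IsBoxRegular P Q t δ) :
    IsBoxRegular P Q (𝔼 x ∈ Fintype.piFinset P, Q x) (2 * δ) := by
  have hΩ : (Fintype.piFinset P).Nonempty := Fintype.piFinset_nonempty.2 hP
  intro w hw
  set m := 𝔼 x ∈ Fintype.piFinset P, Q x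
  have h1 := h w hw
  have h2 := h (fun _ _ => 1) fun _ _ => ⟨zero_le_one, le_rfl⟩
  simp only [prod_const_one, mul_one, expect_sub_distrib, expect_const hΩ] at h2
  have h3 : 𝔼 x ∈ Fintype.piFinset P, (Q x - m) * ∏ i, w i (x i) =
      (𝔼 x ∈ Fintype.piFinset P, (Q x - t) * ∏ i, w i (x i)) -
        (m - t) * 𝔼 x ∈ Fintype.piFinset P, ∏ i, w i (x i) := by
    rw [mul_expect, ← expect_sub_distrib]
    exact expect_congr rfl fun x _ => by ring
  have h4 : 0 ≤ 𝔼 x ∈ Fintype.piFinset P, ∏ i, w i (x i) :=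
    expect_nonneg fun x _ => (prod_weight_mem hw x).1
  have h5 : 𝔼 x ∈ Fintype.piFinset P, ∏ i, w i (x i) ≤ 1 :=
    expect_le hΩ fun x _ => (prod_weight_mem hw x).2
  have h6 : |(m - t) * 𝔼 x ∈ Fintype.piFinset P, ∏ i, w i (x i)| ≤ δ := by
    rw [abs_mul, abs_of_nonneg h4]
    calc _ ≤ |m - t| * 1 := by gcongr
      _ ≤ δ := by rw [mul_one]; exact h2
  rw [h3]
  calc _ ≤ _ := abs_sub _ _
    _ ≤ 2 * δ := by linarith

theorem sum_piFinset_subbox {P P' : ι → Finset V} [DecidableEq V] (h : ∀ i, P' i ⊆ P i)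
    (g : (ι → V) → ℝ) :
    ∑ x ∈ Fintype.piFinset P, g x * ∏ i, (if x i ∈ P' i then (1 : ℝ) else 0) =
      ∑ x ∈ Fintype.piFinset P', g x := by
  rw [← sum_subset (Fintype.piFinset_subset _ _ h)]
  · refine sum_congr rfl fun x hx => ?_
    rw [prod_congr rfl fun i _ => if_pos (Fintype.mem_piFinset.1 hx i), prod_const_one, mul_one]
  · intro x _ hx
    rw [Fintype.mem_piFinset] at hx
    push Not at hx
    obtain ⟨i, hi⟩ := hx
    rw [prod_eq_zero (mem_univ i) (if_neg hi), mul_zero]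

theorem IsBoxRegular.subbox {P P' : ι → Finset V} [DecidableEq V] {Q : (ι → V) → ℝ} {t δ γ : ℝ}
    (hγ : 0 < γ) (h : IsBoxRegular P Q t δ) (hP : ∀ i, (P i).Nonempty)
    (hP' : ∀ i, P' i ⊆ P i) (hc : ∀ i, γ * #(P i) ≤ #(P' i)) :
    IsBoxRegular P' Q t (δ / γ ^ Fintype.card ι) := by
  intro w hw
  have h1 := h (fun i v => w i v * if v ∈ P' i then 1 else 0) fun i v => by
    have := hw i v
    split_ifs <;> simp [this]
  have hcard : (γ ^ Fintype.card ι) * #(Fintype.piFinset P) ≤ #(Fintype.piFinset P') := by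
    rw [Fintype.card_piFinset, Fintype.card_piFinset]
    push_cast
    rw [← card_univ, ← prod_const, ← prod_mul_distrib]
    exact prod_le_prod (fun i _ => by positivity) fun i _ => hc i
  have hpos : (0 : ℝ) < #(Fintype.piFinset P) := by
    exact_mod_cast card_pos.2 (Fintype.piFinset_nonempty.2 hP)
  have hγN : 0 < γ ^ Fintype.card ι := pow_pos hγ _
  have hpos' : (0 : ℝ) < #(Fintype.piFinset P') := (mul_pos hγN hpos).trans_le hcard
  simp only [prod_mul_distrib, ← mul_assoc] at h1
  rw [expect_eq_sum_div_card, sum_piFinset_subbox hP' (fun x => (Q x - t) * ∏ i, w i (x i)),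
    abs_div, abs_of_pos hpos, div_le_iff₀ hpos] at h1
  rw [expect_eq_sum_div_card, abs_div, abs_of_pos hpos', div_le_iff₀ hpos']
  have hδ : 0 ≤ δ := by
    by_contra hneg
    have := mul_neg_of_neg_of_pos (not_le.1 hneg) hpos
    linarith [abs_nonneg (∑ x ∈ Fintype.piFinset P', (Q x - t) * ∏ i, w i (x i))]
  calc _ ≤ _ := h1
    _ = δ / γ ^ Fintype.card ι * (γ ^ Fintype.card ι * #(Fintype.piFinset P)) := by
      field_simp
    _ ≤ _ := by gcongr

/-- One of the weights in a product test can be rounded to an indicator. -/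
theorem exists_indicator_le [Fintype V] [DecidableEq V] (Ω : Finset (ι → V)) (G : (ι → V) → ℝ)
    (s : Finset ι) (w : ι → V → ℝ) (hw : ∀ i v, 0 ≤ w i v ∧ w i v ≤ 1) :
    ∃ w' : ι → V → ℝ, (∀ i v, 0 ≤ w' i v ∧ w' i v ≤ 1) ∧
      (∀ i ∈ s, ∀ v, w' i v = 0 ∨ w' i v = 1) ∧
      ∑ x ∈ Ω, G x * ∏ i, w' i (x i) ≤ ∑ x ∈ Ω, G x * ∏ i, w i (x i) := by
  induction s using Finset.induction_on with
  | empty => exact ⟨w, hw, by simp, le_rfl⟩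
  | insert j s hj ih =>
    obtain ⟨w₁, hw₁, hs, hle⟩ := ih
    set L : V → ℝ := fun v => ∑ x ∈ Ω, if x j = v then G x * ∏ i ∈ univ.erase j, w₁ i (x i) else 0
      with hL
    have key : ∀ u : V → ℝ, ∑ x ∈ Ω, G x * ∏ i, Function.update w₁ j u i (x i) =
        ∑ v, u v * L v := by
      intro u
      simp only [hL, mul_sum]
      rw [sum_comm]
      refine sum_congr rfl fun x _ => ?_
      simp only [mul_ite, mul_zero, sum_ite_eq, mem_univ, if_true]
      rw [← mul_prod_erase univ _ (mem_univ j), Function.update_self]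
      rw [prod_congr rfl fun i hi => by rw [Function.update_of_ne (ne_of_mem_erase hi)]]
      ring
    refine ⟨Function.update w₁ j fun v => if L v < 0 then 1 else 0, ?_, ?_, ?_⟩
    · intro i v
      by_cases hij : i = j
      · subst hij
        rw [Function.update_self]
        split_ifs <;> norm_num
      · rw [Function.update_of_ne hij]
        exact hw₁ i v
    · intro i hi v
      by_cases hij : i = j
      · subst hij
        rw [Function.update_self]
        split_ifs <;> norm_num
      · rw [Function.update_of_ne hij]
        exact hs i ((mem_insert.1 hi).resolve_left hij) v
    · refine le_trans ?_ hle
      conv_rhs => rw [← Function.update_eq_self j w₁]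
      rw [key, key]
      refine sum_le_sum fun v _ => ?_
      have := hw₁ j v
      split_ifs with h <;> nlinarith

end Regular

section Regularize

variable {ι V : Type} [Fintype ι] [DecidableEq ι]

theorem exists_negative_weight {P : ι → Finset V} {Q : (ι → V) → ℝ} {δ : ℝ}
    (hP : ∀ i, (P i).Nonempty) (hδ : 0 < δ)
    (h : ¬ IsBoxRegular P Q (𝔼 x ∈ Fintype.piFinset P, Q x) δ) :
    ∃ w : ι → V → ℝ, (∀ i v, 0 ≤ w i v ∧ w i v ≤ 1) ∧
      𝔼 x ∈ Fintype.piFinset P, (Q x - 𝔼 x ∈ Fintype.piFinset P, Q x) * ∏ i, w i (x i) ≤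
        -(δ / 2 ^ Fintype.card ι) := by
  have hΩ : (Fintype.piFinset P).Nonempty := Fintype.piFinset_nonempty.2 hP
  set t := 𝔼 x ∈ Fintype.piFinset P, Q x with ht
  unfold IsBoxRegular at h
  push Not at h
  obtain ⟨w, hw, hlt⟩ := h
  have hpow : δ / 2 ^ Fintype.card ι ≤ δ :=
    div_le_self hδ.le (one_le_pow₀ (by norm_num))
  rcases lt_abs.1 hlt with hlt | hlt
  · by_contra! hcon
    let w' : Finset ι → ι → V → ℝ := fun s i v => if i ∈ s then w i v else 1 - w i v
    have hw' : ∀ s i v, 0 ≤ w' s i v ∧ w' s i v ≤ 1 := by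
      intro s i v
      have := hw i v
      simp only [w']
      split_ifs
      · exact this
      · constructor <;> linarith
    have hsum : ∑ s : Finset ι, 𝔼 x ∈ Fintype.piFinset P, (Q x - t) * ∏ i, w' s i (x i) = 0 := by
      rw [← expect_sum_comm]
      have : ∀ x : ι → V, ∑ s : Finset ι, (Q x - t) * ∏ i, w' s i (x i) = Q x - t := by
        intro x
        rw [← mul_sum]
        have := prod_add (fun i => w i (x i)) (fun i => 1 - w i (x i)) univ
        simp only [add_sub_cancel, prod_const_one] at this
        have h2 : ∀ s : Finset ι, ∏ i, w' s i (x i) =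
            (∏ i ∈ s, w i (x i)) * ∏ i ∈ univ \ s, (1 - w i (x i)) := by
          intro s
          simp only [w', prod_ite]
          congr 1
          · exact prod_congr (by ext; simp) fun _ _ => rfl
          · exact prod_congr (by ext; simp) fun _ _ => rfl
        simp only [h2]
        rw [powerset_univ] at this
        rw [← this, mul_one]
      simp only [this]
      rw [expect_sub_distrib, expect_const hΩ, ← ht, sub_self]
    have h1 : 𝔼 x ∈ Fintype.piFinset P, (Q x - t) * ∏ i, w' univ i (x i) +
        δ / 2 ^ Fintype.card ι ≤ ∑ s : Finset ι,
          (𝔼 x ∈ Fintype.piFinset P, (Q x - t) * ∏ i, w' s i (x i) + δ / 2 ^ Fintype.card ι) :=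
      single_le_sum (f := fun s => 𝔼 x ∈ Fintype.piFinset P, (Q x - t) * ∏ i, w' s i (x i) +
        δ / 2 ^ Fintype.card ι) (fun s _ => by linarith [hcon (w' s) (hw' s)]) (mem_univ _)
    rw [sum_add_distrib, hsum, sum_const, card_univ, Fintype.card_finset, nsmul_eq_mul] at h1
    push_cast at h1
    rw [mul_div_cancel₀ _ (by positivity)] at h1
    simp only [w', mem_univ, if_true] at h1
    have : 0 < δ / 2 ^ Fintype.card ι := by positivity
    linarith
  · exact ⟨w, hw, by linarith⟩

theorem le_card_of_le_prod_card {P P' : ι → Finset V} {ρ : ℝ} (hP : ∀ i, (P i).Nonempty)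
    (hP' : ∀ i, P' i ⊆ P i)
    (h : ρ * #(Fintype.piFinset P) ≤ #(Fintype.piFinset P')) (j : ι) :
    ρ * #(P j) ≤ #(P' j) := by
  rw [Fintype.card_piFinset, Fintype.card_piFinset, ← mul_prod_erase univ _ (mem_univ j),
    ← mul_prod_erase univ (fun i => #(P' i)) (mem_univ j)] at h
  push_cast at h
  have h1 : (∏ i ∈ univ.erase j, (#(P' i) : ℝ)) ≤ ∏ i ∈ univ.erase j, (#(P i) : ℝ) :=
    prod_le_prod (fun _ _ => by positivity) fun i _ => by exact_mod_cast card_le_card (hP' i)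
  have h2 : (0 : ℝ) < ∏ i ∈ univ.erase j, (#(P i) : ℝ) :=
    prod_pos fun i _ => by exact_mod_cast card_pos.2 (hP i)
  refine le_of_mul_le_mul_right ?_ h2
  calc _ = ρ * (#(P j) * ∏ i ∈ univ.erase j, (#(P i) : ℝ)) := by ring
    _ ≤ _ := h
    _ ≤ _ := by gcongr

/-- If `Q` is not regular on a box then its mean drops noticeably on a large sub-box. -/
theorem exists_subbox_mean_lt [Fintype V] [DecidableEq V] {P : ι → Finset V}
    {Q : (ι → V) → ℝ} {δ : ℝ}
    (hP : ∀ i, (P i).Nonempty) (hQ : ∀ x, 0 ≤ Q x ∧ Q x ≤ 1) (hδ : 0 < δ)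
    (h : ¬ IsBoxRegular P Q (𝔼 x ∈ Fintype.piFinset P, Q x) δ) :
    ∃ P' : ι → Finset V, (∀ i, P' i ⊆ P i) ∧ (∀ i, (P' i).Nonempty) ∧
      (∀ i, δ / 2 ^ Fintype.card ι * #(P i) ≤ #(P' i)) ∧
      𝔼 x ∈ Fintype.piFinset P', Q x ≤
        (𝔼 x ∈ Fintype.piFinset P, Q x) - δ / 2 ^ Fintype.card ι := by
  have hΩ : (Fintype.piFinset P).Nonempty := Fintype.piFinset_nonempty.2 hP
  obtain ⟨w, hw, hle⟩ := exists_negative_weight hP hδ h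
  set t := 𝔼 x ∈ Fintype.piFinset P, Q x with ht
  set ρ := δ / 2 ^ Fintype.card ι with hρ
  have hρ0 : 0 < ρ := by positivity
  obtain ⟨w', -, hind, hle'⟩ :=
    exists_indicator_le (Fintype.piFinset P) (fun x => Q x - t) univ w hw
  have hpos : (0 : ℝ) < #(Fintype.piFinset P) := by exact_mod_cast card_pos.2 hΩ
  rw [expect_eq_sum_div_card, div_le_iff₀ hpos] at hle
  let P' : ι → Finset V := fun i => {v ∈ P i | w' i v = 1}
  have hsub : ∀ i, P' i ⊆ P i := fun i => filter_subset _ _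
  have hw'P : ∀ x ∈ Fintype.piFinset P, ∏ i, w' i (x i) =
      ∏ i, (if x i ∈ P' i then (1 : ℝ) else 0) := by
    intro x hx
    refine prod_congr rfl fun i _ => ?_
    have hxi := Fintype.mem_piFinset.1 hx i
    rcases hind i (mem_univ i) (x i) with h0 | h1
    · simp [P', h0]
    · simp [P', h1, hxi]
  have hS : ∑ x ∈ Fintype.piFinset P', (Q x - t) ≤ -ρ * #(Fintype.piFinset P) := by
    rw [← sum_piFinset_subbox hsub]
    refine le_trans (le_of_eq (sum_congr rfl fun x hx => ?_)) (hle'.trans hle)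
    rw [hw'P x hx]
  have ht1 : t ≤ 1 := expect_le hΩ fun x _ => (hQ x).2
  have hlow : -(#(Fintype.piFinset P') : ℝ) ≤ ∑ x ∈ Fintype.piFinset P', (Q x - t) := by
    have := card_nsmul_le_sum (Fintype.piFinset P') (fun x => Q x - t) (-1)
      fun x _ => by linarith [(hQ x).1]
    rw [nsmul_eq_mul] at this
    linarith
  have hcard : ρ * #(Fintype.piFinset P) ≤ #(Fintype.piFinset P') := by linarith
  have hpos' : (0 : ℝ) < #(Fintype.piFinset P') := (mul_pos hρ0 hpos).trans_le hcard
  have hne : (Fintype.piFinset P').Nonempty := card_pos.1 (by exact_mod_cast hpos')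
  refine ⟨P', hsub, Fintype.piFinset_nonempty.1 hne,
    fun i => le_card_of_le_prod_card hP hsub hcard i, ?_⟩
  rw [expect_eq_sum_div_card, div_le_iff₀ hpos']
  rw [sum_sub_distrib, sum_const, nsmul_eq_mul] at hS
  have hle2 : (#(Fintype.piFinset P') : ℝ) ≤ #(Fintype.piFinset P) := by
    exact_mod_cast card_le_card (Fintype.piFinset_subset _ _ hsub)
  nlinarith

end Regularize

theorem exists_regular_subbox (ι : Type) [Fintype ι] [DecidableEq ι] {δ : ℝ} (hδ : 0 < δ) :
    ∃ γ : ℝ, 0 < γ ∧ ∀ (V : Type) [Fintype V] [DecidableEq V] (P : ι → Finset V)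
      (Q : (ι → V) → ℝ), (∀ i, (P i).Nonempty) → (∀ x, 0 ≤ Q x ∧ Q x ≤ 1) →
      ∃ P' : ι → Finset V, (∀ i, P' i ⊆ P i) ∧ (∀ i, (P' i).Nonempty) ∧
        (∀ i, γ * #(P i) ≤ #(P' i)) ∧ ∃ t, IsBoxRegular P' Q t δ := by
  set ρ := δ / 2 ^ Fintype.card ι with hρ
  have hρ0 : 0 < ρ := by positivity
  have step : ∀ (k : ℕ), ∀ (V : Type) [Fintype V] [DecidableEq V] (P : ι → Finset V)
      (Q : (ι → V) → ℝ), (∀ i, (P i).Nonempty) → (∀ x, 0 ≤ Q x ∧ Q x ≤ 1) →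
      𝔼 x ∈ Fintype.piFinset P, Q x ≤ k * ρ →
      ∃ P' : ι → Finset V, (∀ i, P' i ⊆ P i) ∧ (∀ i, (P' i).Nonempty) ∧
        (∀ i, (min ρ 1) ^ k * #(P i) ≤ #(P' i)) ∧ ∃ t, IsBoxRegular P' Q t δ := by
    intro k
    induction k with
    | zero =>
      intro V _ _ P Q hP hQ hle
      by_cases h : IsBoxRegular P Q (𝔼 x ∈ Fintype.piFinset P, Q x) δ
      · exact ⟨P, fun _ => Subset.rfl, hP, fun i => by simp, _, h⟩
      · obtain ⟨P₁, h1, h2, h3, h4⟩ := exists_subbox_mean_lt hP hQ hδ h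
        have h5 : 0 ≤ 𝔼 x ∈ Fintype.piFinset P₁, Q x := expect_nonneg fun x _ => (hQ x).1
        rw [Nat.cast_zero, zero_mul] at hle
        linarith
    | succ k ih =>
      intro V _ _ P Q hP hQ hle
      have hm0 : 0 < min ρ 1 := lt_min hρ0 one_pos
      by_cases h : IsBoxRegular P Q (𝔼 x ∈ Fintype.piFinset P, Q x) δ
      · refine ⟨P, fun _ => Subset.rfl, hP, fun i => ?_, _, h⟩
        exact mul_le_of_le_one_left (Nat.cast_nonneg _) (pow_le_one₀ hm0.le (min_le_right _ _))
      · obtain ⟨P₁, h1, h2, h3, h4⟩ := exists_subbox_mean_lt hP hQ hδ h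
        obtain ⟨P₂, g1, g2, g3, t, g4⟩ := ih V P₁ Q h2 hQ (by push_cast at hle; linarith)
        refine ⟨P₂, fun i => (g1 i).trans (h1 i), g2, fun i => ?_, t, g4⟩
        calc (min ρ 1) ^ (k + 1) * #(P i) = (min ρ 1) ^ k * (min ρ 1 * #(P i)) := by ring
          _ ≤ (min ρ 1) ^ k * (ρ * #(P i)) := by gcongr; exact min_le_left _ _
          _ ≤ (min ρ 1) ^ k * #(P₁ i) := by gcongr; exact h3 i
          _ ≤ _ := g3 i
  obtain ⟨k, hk⟩ := exists_nat_ge (1 / ρ)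
  refine ⟨(min ρ 1) ^ k, pow_pos (lt_min hρ0 one_pos) _, fun V _ _ P Q hP hQ => ?_⟩
  refine step k V P Q hP hQ ?_
  rw [div_le_iff₀ hρ0] at hk
  exact (expect_le (Fintype.piFinset_nonempty.2 hP) fun x _ => (hQ x).2).trans hk

/-- Finitely many functions can be made regular on a common sub-box of bounded relative size. -/
theorem exists_regular_subbox_family (ι : Type) [Fintype ι] [DecidableEq ι] (s : ℕ) :
    ∀ δ : ℝ, 0 < δ → ∃ γ : ℝ, 0 < γ ∧ ∀ (V κ : Type) [Fintype V] [DecidableEq V] (C : Finset κ)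
      (P : ι → Finset V) (Q : κ → (ι → V) → ℝ), #C = s → (∀ i, (P i).Nonempty) →
      (∀ c x, 0 ≤ Q c x ∧ Q c x ≤ 1) →
      ∃ P' : ι → Finset V, (∀ i, P' i ⊆ P i) ∧ (∀ i, (P' i).Nonempty) ∧
        (∀ i, γ * #(P i) ≤ #(P' i)) ∧ ∀ c ∈ C, ∃ t, IsBoxRegular P' (Q c) t δ := by
  classical
  induction s with
  | zero =>
    refine fun δ hδ => ⟨1, one_pos, fun V κ _ _ C P Q hC hP hQ => ?_⟩
    exact ⟨P, fun _ => Subset.rfl, hP, by simp, by simp [card_eq_zero.1 hC]⟩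
  | succ s ih =>
    intro δ hδ
    obtain ⟨γ₁, hγ₁, h₁⟩ := exists_regular_subbox ι hδ
    obtain ⟨γ₀, hγ₀, h₀⟩ := ih (δ * γ₁ ^ Fintype.card ι) (by positivity)
    refine ⟨γ₁ * γ₀, by positivity, fun V κ _ _ C P Q hC hP hQ => ?_⟩
    obtain ⟨c, C', hc, rfl, hC'⟩ := card_eq_succ.1 hC
    obtain ⟨P₁, a1, a2, a3, a4⟩ := h₀ V κ C' P Q hC' hP hQ
    obtain ⟨P₂, b1, b2, b3, b4⟩ := h₁ V P₁ (Q c) a2 (hQ c)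
    refine ⟨P₂, fun i => (b1 i).trans (a1 i), b2, fun i => ?_, fun d hd => ?_⟩
    · calc γ₁ * γ₀ * #(P i) = γ₁ * (γ₀ * #(P i)) := by ring
        _ ≤ γ₁ * #(P₁ i) := by gcongr; exact a3 i
        _ ≤ _ := b3 i
    · rcases mem_insert.1 hd with rfl | hd
      · exact b4
      · obtain ⟨t, ht⟩ := a4 d hd
        refine ⟨t, ?_⟩
        have := ht.subbox hγ₁ a2 b1 b3
        rwa [mul_div_cancel_right₀ _ (by positivity)] at this

section Freeze

variable {ι V : Type} [Fintype ι] [DecidableEq ι]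

theorem piecewise_mem_piFinset {P : ι → Finset V} {x y : ι → V} (S : Finset ι)
    (hx : x ∈ Fintype.piFinset P) (hy : y ∈ Fintype.piFinset P) :
    S.piecewise y x ∈ Fintype.piFinset P := by
  rw [Fintype.mem_piFinset] at *
  intro i
  by_cases h : i ∈ S
  · simpa [h] using hy i
  · simpa [h] using hx i

/-- Resampling the coordinates in `S` does not change the mean. -/
theorem expect_piecewise (P : ι → Finset V) (S : Finset ι) (g : (ι → V) → ℝ) :
    𝔼 x ∈ Fintype.piFinset P, 𝔼 y ∈ Fintype.piFinset P, g (S.piecewise y x) =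
      𝔼 x ∈ Fintype.piFinset P, g x := by
  rcases (Fintype.piFinset P).eq_empty_or_nonempty with h0 | hne
  · simp [h0]
  calc 𝔼 x ∈ Fintype.piFinset P, 𝔼 y ∈ Fintype.piFinset P, g (S.piecewise y x)
      = 𝔼 z ∈ Fintype.piFinset P ×ˢ Fintype.piFinset P, g (S.piecewise z.2 z.1) := by
        rw [expect_product]
    _ = 𝔼 z ∈ Fintype.piFinset P ×ˢ Fintype.piFinset P, g z.1 := by
        refine expect_nbij' (fun z => (S.piecewise z.2 z.1, S.piecewise z.1 z.2))
          (fun z => (S.piecewise z.2 z.1, S.piecewise z.1 z.2)) ?_ ?_ ?_ ?_ ?_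
        · rintro ⟨x, y⟩ h
          rw [mem_product] at h ⊢
          exact ⟨piecewise_mem_piFinset S h.1 h.2, piecewise_mem_piFinset S h.2 h.1⟩
        · rintro ⟨x, y⟩ h
          rw [mem_product] at h ⊢
          exact ⟨piecewise_mem_piFinset S h.1 h.2, piecewise_mem_piFinset S h.2 h.1⟩
        · rintro ⟨x, y⟩ -
          ext i <;> by_cases h : i ∈ S <;> simp [h]
        · rintro ⟨x, y⟩ -
          ext i <;> by_cases h : i ∈ S <;> simp [h]
        · rintro ⟨x, y⟩ -
          rfl
    _ = 𝔼 x ∈ Fintype.piFinset P, 𝔼 y ∈ Fintype.piFinset P, g x := by rw [expect_product]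
    _ = _ := expect_congr rfl fun x _ => expect_const hne _

/-- A product of functions, each depending on at most one coordinate in `S`, becomes a product of
one-variable weights once the coordinates outside `S` are fixed. -/
theorem exists_weight_of_prod {κ : Type} (C : Finset κ) (S : Finset ι) (W : κ → Finset ι)
    (φ : κ → (ι → V) → ℝ) (hφ : ∀ s ∈ C, ∀ x, 0 ≤ φ s x ∧ φ s x ≤ 1)
    (hdep : ∀ s ∈ C, DependsOn (φ s) (W s : Set ι)) (hW : ∀ s ∈ C, #(W s ∩ S) ≤ 1) (x : ι → V) :
    ∃ c : ℝ, 0 ≤ c ∧ c ≤ 1 ∧ ∃ w : ι → V → ℝ, (∀ i v, 0 ≤ w i v ∧ w i v ≤ 1) ∧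
      ∀ y, ∏ s ∈ C, φ s (S.piecewise y x) = c * ∏ i, w i (y i) := by
  classical
  induction C using Finset.induction_on with
  | empty => exact ⟨1, zero_le_one, le_rfl, fun _ _ => 1, fun _ _ => ⟨zero_le_one, le_rfl⟩, by simp⟩
  | insert s C hs ih =>
    obtain ⟨c, hc0, hc1, w, hw, he⟩ := ih (fun s h => hφ s (mem_insert_of_mem h))
      (fun s h => hdep s (mem_insert_of_mem h)) (fun s h => hW s (mem_insert_of_mem h))
    have hφs := hφ s (mem_insert_self _ _)
    have hds := hdep s (mem_insert_self _ _)
    have hWs := hW s (mem_insert_self _ _)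
    simp only [prod_insert hs, he]
    rcases Nat.lt_or_ge 0 #(W s ∩ S) with h | h
    · obtain ⟨j, hj⟩ := card_eq_one.1 (le_antisymm hWs h)
      refine ⟨c, hc0, hc1, fun i v => if i = j then φ s (Function.update x j v) * w i v else w i v,
        fun i v => ?_, fun y => ?_⟩
      · have h1 := hw i v
        have h2 := hφs (Function.update x j v)
        beta_reduce
        split_ifs
        · exact ⟨mul_nonneg h2.1 h1.1, mul_le_one₀ h2.2 h1.1 h1.2⟩
        · exact h1
      · have h3 : φ s (S.piecewise y x) = φ s (Function.update x j (y j)) := by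
          refine hds fun i hi => ?_
          by_cases hij : i = j
          · subst hij
            have : i ∈ S := (mem_inter.1 (hj ▸ mem_singleton_self i)).2
            simp [this]
          · have : i ∉ S := fun hS => hij (mem_singleton.1 (hj ▸ mem_inter.2 ⟨hi, hS⟩))
            simp [this, hij]
        rw [h3, ← mul_prod_erase univ _ (mem_univ j),
          ← mul_prod_erase univ (fun i => if i = j then φ s (Function.update x j (y i)) * w i (y i)
            else w i (y i)) (mem_univ j), if_pos rfl,
          prod_congr rfl fun i hi => if_neg (ne_of_mem_erase hi)]
        ring
    · have h3 : ∀ y, φ s (S.piecewise y x) = φ s x := fun y => hds fun i hi => by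
        have : i ∉ S := fun hS => by
          have := mem_inter.2 ⟨hi, hS⟩
          rw [card_eq_zero.1 (Nat.le_zero.1 h)] at this
          simp at this
        simp [this]
      refine ⟨φ s x * c, mul_nonneg (hφs x).1 hc0, mul_le_one₀ (hφs x).2 hc0 hc1, w, hw,
        fun y => ?_⟩
      rw [h3, mul_assoc]

/-- Regularity of `Q` also controls products of functions that each share at most one coordinate
with `Q`. -/
theorem IsBoxRegular.abs_expect_mul_prod_le {P : ι → Finset V} {Q : (ι → V) → ℝ} {t δ : ℝ}
    (h : IsBoxRegular P Q t δ) (hP : ∀ i, (P i).Nonempty) (S : Finset ι)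
    (hQ : DependsOn Q (S : Set ι)) {κ : Type} (C : Finset κ) (W : κ → Finset ι)
    (φ : κ → (ι → V) → ℝ) (hφ : ∀ s ∈ C, ∀ x, 0 ≤ φ s x ∧ φ s x ≤ 1)
    (hdep : ∀ s ∈ C, DependsOn (φ s) (W s : Set ι)) (hW : ∀ s ∈ C, #(W s ∩ S) ≤ 1) :
    |𝔼 x ∈ Fintype.piFinset P, (Q x - t) * ∏ s ∈ C, φ s x| ≤ δ := by
  have hΩ : (Fintype.piFinset P).Nonempty := Fintype.piFinset_nonempty.2 hP
  have key : ∀ x, |𝔼 y ∈ Fintype.piFinset P,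
      (Q (S.piecewise y x) - t) * ∏ s ∈ C, φ s (S.piecewise y x)| ≤ δ := by
    intro x
    obtain ⟨c, hc0, hc1, w, hw, he⟩ := exists_weight_of_prod C S W φ hφ hdep hW x
    have h1 : ∀ y, Q (S.piecewise y x) = Q y := fun y => hQ fun i hi => by
      have : i ∈ S := hi
      simp [this]
    have h2 : 𝔼 y ∈ Fintype.piFinset P,
        (Q (S.piecewise y x) - t) * ∏ s ∈ C, φ s (S.piecewise y x) =
          c * 𝔼 y ∈ Fintype.piFinset P, (Q y - t) * ∏ i, w i (y i) := by
      rw [mul_expect]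
      refine expect_congr rfl fun y _ => ?_
      rw [h1, he]
      ring
    rw [h2, abs_mul, abs_of_nonneg hc0]
    exact (mul_le_of_le_one_left (abs_nonneg _) hc1).trans (h w hw)
  rw [← expect_piecewise P S fun x => (Q x - t) * ∏ s ∈ C, φ s x, abs_le]
  exact ⟨le_expect hΩ fun x _ => (abs_le.1 (key x)).1,
    expect_le hΩ fun x _ => (abs_le.1 (key x)).2⟩

theorem IsBoxRegular.le_expect_mul_prod {P : ι → Finset V} {Q : (ι → V) → ℝ} {t δ c : ℝ}
    (h : IsBoxRegular P Q t δ) (hP : ∀ i, (P i).Nonempty) (hct : c ≤ t) (S : Finset ι)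
    (hQ : DependsOn Q (S : Set ι)) {κ : Type} (C : Finset κ) (W : κ → Finset ι)
    (φ : κ → (ι → V) → ℝ) (hφ : ∀ s ∈ C, ∀ x, 0 ≤ φ s x ∧ φ s x ≤ 1)
    (hdep : ∀ s ∈ C, DependsOn (φ s) (W s : Set ι)) (hW : ∀ s ∈ C, #(W s ∩ S) ≤ 1) :
    c * (𝔼 x ∈ Fintype.piFinset P, ∏ s ∈ C, φ s x) - δ ≤
      𝔼 x ∈ Fintype.piFinset P, Q x * ∏ s ∈ C, φ s x := by
  have h1 := (abs_le.1 (h.abs_expect_mul_prod_le hP S hQ C W φ hφ hdep hW)).1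
  simp only [sub_mul, expect_sub_distrib, ← mul_expect] at h1
  have h2 : 0 ≤ 𝔼 x ∈ Fintype.piFinset P, ∏ s ∈ C, φ s x :=
    expect_nonneg fun x _ => prod_nonneg fun s hs => (hφ s hs x).1
  nlinarith

end Freeze

section Marginals

variable {ι V : Type} [Fintype ι] [DecidableEq ι]

theorem expect_prod_piFinset (P : ι → Finset V) (w : ι → V → ℝ) :
    𝔼 x ∈ Fintype.piFinset P, ∏ i, w i (x i) = ∏ i, 𝔼 v ∈ P i, w i v := by
  simp only [expect_eq_sum_div_card]
  rw [← prod_univ_sum, Fintype.card_piFinset, Nat.cast_prod, prod_div_distrib]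

theorem expect_apply_piFinset {P : ι → Finset V} (hP : ∀ i, (P i).Nonempty) (j : ι) (k : V → ℝ) :
    𝔼 x ∈ Fintype.piFinset P, k (x j) = 𝔼 v ∈ P j, k v := by
  have := expect_prod_piFinset P fun i v => if i = j then k v else 1
  simp only [prod_ite_eq', mem_univ, if_true] at this
  rw [this, ← mul_prod_erase univ _ (mem_univ j)]
  simp only [if_true]
  rw [prod_eq_one, mul_one]
  intro i hi
  simp only [ne_of_mem_erase hi, if_false]
  exact expect_const (hP i) _

theorem expect_update_piFinset {P : ι → Finset V} (hP : ∀ i, (P i).Nonempty) (j : ι)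
    (G : (ι → V) → ℝ) :
    𝔼 x ∈ Fintype.piFinset P, 𝔼 v ∈ P j, G (Function.update x j v) =
      𝔼 x ∈ Fintype.piFinset P, G x := by
  rw [← expect_piecewise P {j} G]
  refine expect_congr rfl fun x _ => ?_
  rw [← expect_apply_piFinset hP j fun v => G (Function.update x j v)]
  refine expect_congr rfl fun y _ => ?_
  rw [piecewise_singleton]

theorem expect_three_piFinset {P : ι → Finset V} (hP : ∀ i, (P i).Nonempty) {i j k : ι}
    (hij : i ≠ j) (hik : i ≠ k) (hjk : j ≠ k) (h : V → V → V → ℝ) :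
    𝔼 x ∈ Fintype.piFinset P, h (x i) (x j) (x k) =
      𝔼 a ∈ P i, 𝔼 b ∈ P j, 𝔼 c ∈ P k, h a b c := by
  rw [← expect_update_piFinset hP k]
  simp only [Function.update_self, Function.update_of_ne hik, Function.update_of_ne hjk]
  rw [← expect_update_piFinset hP j]
  simp only [Function.update_self, Function.update_of_ne hij]
  exact expect_apply_piFinset hP i fun a => 𝔼 b ∈ P j, 𝔼 c ∈ P k, h a b c

end Marginals

section EdgeIndicator

variable {ι V : Type} [DecidableEq V]

/-- The indicator that `x` maps every set in `E` to an edge of `H`. -/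
def edgeInd (H : ThreeGraph V) (E : Finset (Finset ι)) (x : ι → V) : ℝ :=
  ∏ e ∈ E, if e.image x ∈ H.edges then 1 else 0

theorem edgeInd_mem (H : ThreeGraph V) (E : Finset (Finset ι)) (x : ι → V) :
    0 ≤ edgeInd H E x ∧ edgeInd H E x ≤ 1 :=
  ⟨prod_nonneg fun _ _ => by split_ifs <;> norm_num,
    prod_le_one (fun _ _ => by split_ifs <;> norm_num) fun _ _ => by split_ifs <;> norm_num⟩

theorem edgeInd_eq_ite (H : ThreeGraph V) (E : Finset (Finset ι)) (x : ι → V) :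
    edgeInd H E x = if ∀ e ∈ E, e.image x ∈ H.edges then 1 else 0 := by
  unfold edgeInd
  rw [prod_boole]

theorem edgeInd_dependsOn (H : ThreeGraph V) (E : Finset (Finset ι)) (S : Finset ι)
    (h : ∀ e ∈ E, e ⊆ S) : DependsOn (edgeInd H E) (S : Set ι) := by
  intro x y hxy
  unfold edgeInd
  refine prod_congr rfl fun e he => ?_
  rw [image_congr fun i hi => hxy i (h e he hi)]

end EdgeIndicator

section WeightedDensity

variable {V : Type} [DecidableEq V]

theorem exists_vertex_le [Fintype V] (g : (V → ℝ) → ℝ)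
    (hg : ∀ u v s, g (Function.update u v s) =
      (1 - s) * g (Function.update u v 0) + s * g (Function.update u v 1))
    (u : V → ℝ) (hu : ∀ v, 0 ≤ u v ∧ u v ≤ 1) :
    ∃ W : Finset V, g (fun v => if v ∈ W then 1 else 0) ≤ g u := by
  have main : ∀ s : Finset V, ∃ u' : V → ℝ, (∀ v, 0 ≤ u' v ∧ u' v ≤ 1) ∧
      (∀ v ∈ s, u' v = 0 ∨ u' v = 1) ∧ g u' ≤ g u := by
    intro s
    induction s using Finset.induction_on with
    | empty => exact ⟨u, hu, by simp, le_rfl⟩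
    | insert j s hj ih =>
      obtain ⟨u₁, h1, h2, h3⟩ := ih
      have h4 := hg u₁ j (u₁ j)
      rw [Function.update_eq_self] at h4
      have hj1 := h1 j
      obtain ⟨b, hb, hle⟩ : ∃ b : ℝ, (b = 0 ∨ b = 1) ∧ g (Function.update u₁ j b) ≤ g u₁ := by
        by_cases h : g (Function.update u₁ j 0) ≤ g (Function.update u₁ j 1)
        · exact ⟨0, .inl rfl, by nlinarith⟩
        · exact ⟨1, .inr rfl, by nlinarith⟩
      refine ⟨Function.update u₁ j b, fun v => ?_, fun v hv => ?_, hle.trans h3⟩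
      · by_cases hvj : v = j
        · subst hvj
          rcases hb with rfl | rfl <;> simp
        · rw [Function.update_of_ne hvj]
          exact h1 v
      · by_cases hvj : v = j
        · subst hvj
          rwa [Function.update_self]
        · rw [Function.update_of_ne hvj]
          exact h2 v ((mem_insert.1 hv).resolve_left hvj)
  obtain ⟨u', -, h2, h3⟩ := main univ
  refine ⟨univ.filter fun v => u' v = 1, ?_⟩
  convert h3 using 2
  ext v
  rcases h2 v (mem_univ v) with h | h <;> simp [h]

theorem prod_update_affine (e : Finset V) (u : V → ℝ) (v : V) (s : ℝ) :
    ∏ i ∈ e, Function.update u v s i = (1 - s) * ∏ i ∈ e, Function.update u v 0 i +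
      s * ∏ i ∈ e, Function.update u v 1 i := by
  by_cases hv : v ∈ e
  · simp only [prod_update_of_mem hv]
    ring
  · simp only [prod_update_of_notMem hv]
    ring

/-- A uniformly dense 3-graph is also dense with respect to vertex weights. -/
theorem UniformlyDense.weighted {n : ℕ} {H : ThreeGraph (Fin n)} {d η : ℝ}
    (hH : UniformlyDense H d η) (u : Fin n → ℝ) (hu : ∀ v, 0 ≤ u v ∧ u v ≤ 1) :
    d * (∑ e ∈ powersetCard 3 (univ : Finset (Fin n)), ∏ v ∈ e, u v) - η * n ^ 3 ≤
      ∑ e ∈ H.edges, ∏ v ∈ e, u v := by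
  obtain ⟨W, hW⟩ := exists_vertex_le (fun u : Fin n → ℝ => (∑ e ∈ H.edges, ∏ v ∈ e, u v) -
      d * ∑ e ∈ powersetCard 3 (univ : Finset (Fin n)), ∏ v ∈ e, u v) (by
    intro u v s
    simp only [prod_update_affine _ u v s, sum_add_distrib, ← mul_sum]
    ring) u hu
  have h1 : ∀ A : Finset (Finset (Fin n)),
      ∑ e ∈ A, ∏ v ∈ e, (if v ∈ W then (1 : ℝ) else 0) = #{e ∈ A | e ⊆ W} := by
    intro A
    simp only [prod_boole, ← sum_boole]
    rfl
  have h2 : #{e ∈ powersetCard 3 (univ : Finset (Fin n)) | e ⊆ W} = (#W).choose 3 := by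
    rw [← card_powersetCard]
    congr 1
    ext e
    simp [mem_powersetCard, and_comm]
  have h3 := hH W
  simp only [h1, h2] at hW
  linarith

end WeightedDensity

section TripleSums

variable {V : Type} [DecidableEq V]

theorem one_le_coincidences {a b c : V} (h : ¬ (a ≠ b ∧ a ≠ c ∧ b ≠ c)) :
    (1 : ℝ) ≤ ((if a = b then (1 : ℝ) else 0) + (if a = c then 1 else 0)) +
      if b = c then 1 else 0 := by
  split_ifs <;> first | (exfalso; tauto) | norm_num

theorem sum_three_coincidences (U : Finset V) :
    ∑ a ∈ U, ∑ b ∈ U, ∑ c ∈ U, (((if a = b then (1 : ℝ) else 0) + (if a = c then 1 else 0)) +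
      if b = c then 1 else 0) = 3 * (#U : ℝ) ^ 2 := by
  have h1 : ∀ a ∈ U, ∀ b ∈ U, ∑ c ∈ U, (((if a = b then (1 : ℝ) else 0) +
      (if a = c then 1 else 0)) + if b = c then 1 else 0) = #U * (if a = b then 1 else 0) + 2 := by
    intro a ha b hb
    rw [sum_add_distrib, sum_add_distrib, sum_ite_eq, sum_ite_eq, if_pos ha, if_pos hb, sum_const,
      nsmul_eq_mul]
    ring
  have h2 : ∀ a ∈ U, ∑ b ∈ U, ((#U : ℝ) * (if a = b then 1 else 0) + 2) = 3 * #U := by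
    intro a ha
    rw [sum_add_distrib, ← mul_sum, sum_ite_eq, if_pos ha, sum_const, nsmul_eq_mul]
    ring
  rw [sum_congr rfl fun a ha => (sum_congr rfl fun b hb => h1 a ha b hb).trans (h2 a ha),
    sum_const, nsmul_eq_mul]
  ring

theorem pow_sum_le_sum_triples [Fintype V] (u : V → ℝ) (hu : ∀ v, 0 ≤ u v ∧ u v ≤ 1) :
    (∑ v, u v) ^ 3 ≤ 3 * (Fintype.card V : ℝ) ^ 2 +
      27 * ∑ e ∈ powersetCard 3 (univ : Finset V), ∏ v ∈ e, u v := by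
  have hprod : ∀ e : Finset V, 0 ≤ ∏ v ∈ e, u v := fun e => prod_nonneg fun v _ => (hu v).1
  have h0 : (∑ v, u v) ^ 3 = ∑ a, ∑ b, ∑ c, u a * u b * u c := by
    rw [pow_three, sum_mul]
    refine sum_congr rfl fun a _ => ?_
    rw [sum_mul_sum, mul_sum]
    refine sum_congr rfl fun b _ => ?_
    rw [mul_sum]
    exact sum_congr rfl fun c _ => by ring
  have h1 : ∑ a : V, ∑ b : V, ∑ c : V, ∑ e ∈ powersetCard 3 (univ : Finset V),
      (if a ∈ e then if b ∈ e then if c ∈ e then ∏ v ∈ e, u v else 0 else 0 else 0) =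
        27 * ∑ e ∈ powersetCard 3 (univ : Finset V), ∏ v ∈ e, u v := by
    have : ∀ e ∈ powersetCard 3 (univ : Finset V), ∑ a : V, ∑ b : V, ∑ c : V,
        (if a ∈ e then if b ∈ e then if c ∈ e then ∏ v ∈ e, u v else 0 else 0 else 0) =
          27 * ∏ v ∈ e, u v := by
      intro e he
      have hc : #e = 3 := (mem_powersetCard.1 he).2
      have : ∀ (x : ℝ), ∑ c : V, (if c ∈ e then x else 0) = 3 * x := by
        intro x
        rw [sum_ite_mem, univ_inter, sum_const, hc, nsmul_eq_mul]
        norm_num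
      simp only [sum_ite_irrel, sum_const_zero, this]
      ring
    rw [mul_sum, ← sum_congr rfl this]
    symm
    rw [sum_comm]
    refine sum_congr rfl fun a _ => ?_
    rw [sum_comm]
    refine sum_congr rfl fun b _ => ?_
    rw [sum_comm]
  rw [h0, ← h1, ← card_univ, ← sum_three_coincidences]
  simp only [← sum_add_distrib]
  refine sum_le_sum fun a _ => sum_le_sum fun b _ => sum_le_sum fun c _ => ?_
  have hs : 0 ≤ ∑ e ∈ powersetCard 3 (univ : Finset V),
      (if a ∈ e then if b ∈ e then if c ∈ e then ∏ v ∈ e, u v else 0 else 0 else 0) :=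
    sum_nonneg fun e _ => by split_ifs <;> simp [hprod]
  have ha := hu a
  have hb := hu b
  have hc := hu c
  have hle : u a * u b * u c ≤ 1 :=
    mul_le_one₀ (mul_le_one₀ ha.2 hb.1 hb.2) hc.1 hc.2
  by_cases hd : a ≠ b ∧ a ≠ c ∧ b ≠ c
  swap
  · linarith [one_le_coincidences hd]
  obtain ⟨hab, hac, hbc⟩ := hd
  simp only [hab, hac, hbc, if_false]
  have h2 := single_le_sum (f := fun e => if a ∈ e then if b ∈ e then if c ∈ e then
    ∏ v ∈ e, u v else 0 else 0 else 0) (fun e _ => by split_ifs <;> simp [hprod])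
    (mem_powersetCard.2 ⟨subset_univ _, card_eq_three.2 ⟨a, b, c, hab, hac, hbc, rfl⟩⟩)
  simp [hab, hac, hbc] at h2
  rw [mul_assoc]
  linarith

theorem sum_edges_le_sum_triples [Fintype V] (H : ThreeGraph V) (u : V → ℝ) (hu : ∀ v, 0 ≤ u v) :
    ∑ e ∈ H.edges, ∏ v ∈ e, u v ≤
      ∑ a, u a * ∑ b, u b * ∑ c, u c * (if ({a, b, c} : Finset V) ∈ H.edges then 1 else 0) := by
  have h1 : ∀ e ∈ H.edges, ∏ v ∈ e, u v ≤ ∑ a, ∑ b, ∑ c,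
      (if ({a, b, c} : Finset V) = e then u a * u b * u c else 0) := by
    intro e he
    obtain ⟨a, b, c, hab, hac, hbc, rfl⟩ := card_eq_three.1 (H.card_eq e he)
    have hnn : ∀ a' b' c' : V, 0 ≤
        (if ({a', b', c'} : Finset V) = {a, b, c} then u a' * u b' * u c' else 0) := by
      intro a' b' c'
      have := mul_nonneg (mul_nonneg (hu a') (hu b')) (hu c')
      split_ifs <;> simp [this]
    calc ∏ v ∈ ({a, b, c} : Finset V), u v
        = (if ({a, b, c} : Finset V) = {a, b, c} then u a * u b * u c else 0) := by
          rw [if_pos rfl, prod_insert (by simp [hab, hac]), prod_pair hbc, mul_assoc]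
      _ ≤ ∑ c', (if ({a, b, c'} : Finset V) = {a, b, c} then u a * u b * u c' else 0) :=
          single_le_sum (f := fun c' => if ({a, b, c'} : Finset V) = {a, b, c} then
            u a * u b * u c' else 0) (fun c' _ => hnn a b c') (mem_univ c)
      _ ≤ ∑ b', ∑ c', (if ({a, b', c'} : Finset V) = {a, b, c} then u a * u b' * u c' else 0) :=
          single_le_sum (f := fun b' => ∑ c', if ({a, b', c'} : Finset V) = {a, b, c} then
            u a * u b' * u c' else 0) (fun b' _ => sum_nonneg fun c' _ => hnn a b' c') (mem_univ b)
      _ ≤ _ :=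
          single_le_sum (f := fun a' => ∑ b', ∑ c', if ({a', b', c'} : Finset V) = {a, b, c} then
            u a' * u b' * u c' else 0)
            (fun a' _ => sum_nonneg fun b' _ => sum_nonneg fun c' _ => hnn a' b' c') (mem_univ a)
  refine (sum_le_sum h1).trans (le_of_eq ?_)
  rw [sum_comm]
  refine sum_congr rfl fun a _ => ?_
  rw [sum_comm, mul_sum]
  refine sum_congr rfl fun b _ => ?_
  rw [sum_comm, mul_sum, mul_sum]
  refine sum_congr rfl fun c _ => ?_
  rw [sum_ite_eq]
  split_ifs <;> ring

end TripleSums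

/-- Among sufficiently many large parts of a uniformly dense 3-graph, some three span a positive
proportion of the possible edges. -/
theorem exists_dense_triple {d : ℝ} (hd : 0 < d) :
    ∃ m : ℕ, ∃ ε : ℝ, 0 < ε ∧ ∀ γ : ℝ, 0 < γ → ∃ η : ℝ, 0 < η ∧ ∃ n₀ : ℕ,
      ∀ (ι : Type) [Fintype ι] [DecidableEq ι] (n : ℕ) (H : ThreeGraph (Fin n))
        (P : ι → Finset (Fin n)),
        n₀ ≤ n → UniformlyDense H d η → (∀ i, γ * n ≤ #(P i)) → (∀ i, (P i).Nonempty) →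
        ∀ U : Finset ι, #U = m → ∃ T ⊆ U, #T = 3 ∧
          ε ≤ 𝔼 x ∈ Fintype.piFinset P, edgeInd H {T} x := by
  obtain ⟨m, hm⟩ := exists_nat_gt (648 / d)
  have hm0 : (0 : ℝ) < m := lt_trans (by positivity) hm
  rw [div_lt_iff₀ hd] at hm
  refine ⟨m, d / 216, by positivity, fun γ hγ => ?_⟩
  set lam := γ / m with hlam
  have hlam0 : 0 < lam := by positivity
  obtain ⟨n₀, hn₀⟩ := exists_nat_gt (24 / (lam ^ 3 * m ^ 3))
  refine ⟨d / 216 * (lam ^ 3 * m ^ 3), by positivity, n₀, ?_⟩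
  intro ι _ _ n H P hn hH hPγ hP U hU
  by_contra! hcon
  have hn24 : 24 < n * (lam ^ 3 * m ^ 3) := by
    rw [div_lt_iff₀ (by positivity)] at hn₀
    refine hn₀.trans_le ?_
    gcongr
  have hn0 : (0 : ℝ) < n := by
    by_contra h
    have : (n : ℝ) = 0 := le_antisymm (not_lt.1 h) (Nat.cast_nonneg n)
    rw [this, zero_mul] at hn24
    linarith
  have hPpos : ∀ i, (0 : ℝ) < #(P i) := fun i => by exact_mod_cast card_pos.2 (hP i)
  let u : Fin n → ℝ := fun v => ∑ i ∈ U, if v ∈ P i then lam * n / #(P i) else 0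
  have hu : ∀ v, 0 ≤ u v ∧ u v ≤ 1 := by
    intro v
    constructor
    · exact sum_nonneg fun i _ => by split_ifs <;> positivity
    · have : u v ≤ ∑ i ∈ U, (1 / m : ℝ) := by
        refine sum_le_sum fun i _ => ?_
        split_ifs
        · rw [div_le_div_iff₀ (hPpos i) hm0, hlam]
          field_simp
          have := hPγ i
          linarith
        · positivity
      rw [sum_const, hU, nsmul_eq_mul, mul_one_div_cancel hm0.ne'] at this
      exact this
  have hlin : ∀ g : Fin n → ℝ, ∑ v, u v * g v = lam * n * ∑ i ∈ U, 𝔼 v ∈ P i, g v := by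
    intro g
    simp only [u, sum_mul]
    rw [sum_comm, mul_sum]
    refine sum_congr rfl fun i _ => ?_
    rw [expect_eq_sum_div_card]
    simp only [ite_mul, zero_mul, sum_ite_mem, univ_inter, ← mul_sum]
    field_simp
  have hsum : ∑ v, u v = lam * n * m := by
    have := hlin fun _ => 1
    simp only [mul_one] at this
    rw [this, sum_congr rfl fun i _ => expect_const (hP i) (1 : ℝ), sum_const, hU, nsmul_eq_mul,
      mul_one]
  have h1 := hH.weighted u hu
  have h2 := pow_sum_le_sum_triples u hu
  have h3 := sum_edges_le_sum_triples H u fun v => (hu v).1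
  rw [hsum, Fintype.card_fin] at h2
  have h4 : ∑ a, u a * ∑ b, u b * ∑ c, u c *
      (if ({a, b, c} : Finset (Fin n)) ∈ H.edges then 1 else 0) ≤
      (lam * n) ^ 3 * (d / 216 * m ^ 3 + 3 * m ^ 2) := by
    simp only [hlin, ← mul_expect, expect_sum_comm, ← mul_sum]
    have h5 : ∑ i ∈ U, ∑ j ∈ U, ∑ k ∈ U, 𝔼 a ∈ P i, 𝔼 b ∈ P j, 𝔼 c ∈ P k,
        (if ({a, b, c} : Finset (Fin n)) ∈ H.edges then (1 : ℝ) else 0) ≤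
        ∑ i ∈ U, ∑ j ∈ U, ∑ k ∈ U, (d / 216 + (((if i = j then (1 : ℝ) else 0) +
          (if i = k then 1 else 0)) + if j = k then 1 else 0)) := by
      refine sum_le_sum fun i hi => sum_le_sum fun j hj => sum_le_sum fun k hk => ?_
      by_cases hd' : i ≠ j ∧ i ≠ k ∧ j ≠ k
      · obtain ⟨hij, hik, hjk⟩ := hd'
        rw [← expect_three_piFinset hP hij hik hjk
          fun a b c => if ({a, b, c} : Finset (Fin n)) ∈ H.edges then (1 : ℝ) else 0]
        have h6 := hcon {i, j, k} (by simp [insert_subset_iff, hi, hj, hk])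
          (card_eq_three.2 ⟨i, j, k, hij, hik, hjk, rfl⟩)
        simp only [edgeInd, prod_singleton, image_insert, image_singleton] at h6
        simp only [hij, hik, hjk, if_false]
        linarith
      · have h7 : 𝔼 a ∈ P i, 𝔼 b ∈ P j, 𝔼 c ∈ P k,
            (if ({a, b, c} : Finset (Fin n)) ∈ H.edges then (1 : ℝ) else 0) ≤ 1 :=
          expect_le (hP i) fun a _ => expect_le (hP j) fun b _ => expect_le (hP k) fun c _ => by
            split_ifs <;> norm_num
        have h8 := one_le_coincidences hd'
        have : 0 < d / 216 := by positivity
        linarith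
    have h6 : ∑ i ∈ U, ∑ j ∈ U, ∑ k ∈ U, (d / 216 + (((if i = j then (1 : ℝ) else 0) +
          (if i = k then 1 else 0)) + if j = k then 1 else 0)) = d / 216 * m ^ 3 + 3 * m ^ 2 := by
      rw [← hU, ← sum_three_coincidences U, hU]
      simp only [sum_add_distrib, sum_const, nsmul_eq_mul, hU]
      ring
    rw [← h6]
    calc _ = (lam * n) ^ 3 * ∑ i ∈ U, ∑ j ∈ U, ∑ k ∈ U, 𝔼 a ∈ P i, 𝔼 b ∈ P j, 𝔼 c ∈ P k,
        (if ({a, b, c} : Finset (Fin n)) ∈ H.edges then (1 : ℝ) else 0) := by ring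
      _ ≤ _ := by gcongr
  have h5 : d * (lam * n * m) ^ 3 ≤ d * (3 * n ^ 2) + 27 * ((lam * n) ^ 3 *
      (d / 216 * m ^ 3 + 3 * m ^ 2) + d / 216 * (lam ^ 3 * m ^ 3) * n ^ 3) := by
    have := mul_le_mul_of_nonneg_left h2 hd.le
    linarith
  have h6 : 648 * ((lam * n) ^ 3 * m ^ 2) < m * d * ((lam * n) ^ 3 * m ^ 2) := by gcongr
  have h7 : d * n ^ 2 * 24 ≤ d * n ^ 2 * (n * (lam ^ 3 * m ^ 3)) := by gcongr
  have h8 : 0 < d * (lam ^ 3 * n ^ 3 * m ^ 3) := by positivity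
  nlinarith

theorem strictMono_cons {ι : Type*} [Preorder ι] {k : ℕ} {a : ι} {θ : Fin k → ι}
    (ha : ∀ i, a < θ i) (hθ : StrictMono θ) : StrictMono (Fin.cons a θ : Fin (k + 1) → ι) := by
  intro i j hij
  induction j using Fin.cases with
  | zero => exact absurd hij (Fin.not_lt_zero i)
  | succ j =>
    induction i using Fin.cases with
    | zero => simpa using ha j
    | succ i => simpa using hθ (Fin.succ_lt_succ_iff.1 hij)

/-- The triples formed by the pair `i, j` and the values of `z`. -/
def pairStar {ι : Type} [DecidableEq ι] {r : ℕ} (i j : ι) (z : Fin r → ι) : Finset (Finset ι) :=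
  univ.image fun k => {i, j, z k}

theorem expect_edgeInd {ι V : Type} [DecidableEq V] (Ω : Finset (ι → V)) (H : ThreeGraph V)
    (E : Finset (Finset ι)) :
    𝔼 x ∈ Ω, edgeInd H E x = prob Ω fun x => ∀ e ∈ E, e.image x ∈ H.edges := by
  unfold prob
  refine expect_congr rfl fun x _ => ?_
  rw [edgeInd_eq_ite]
  congr

/-- In a set of parts all of whose triples are dense one finds a pair whose common extensions to
`r` further parts are dense. -/
theorem exists_dense_star (r : ℕ) {ε : ℝ} (hε : 0 < ε) :
    ∃ ε' : ℝ, 0 < ε' ∧ ∃ m : ℕ, ∀ (ι V : Type) [Fintype ι] [LinearOrder ι] [DecidableEq V]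
      (H : ThreeGraph V) (P : ι → Finset V) (U : Finset ι), (∀ i, (P i).Nonempty) → #U = m →
      (∀ T ⊆ U, #T = 3 → ε ≤ 𝔼 x ∈ Fintype.piFinset P, edgeInd H {T} x) →
      ∃ θ : Fin (r + 2) → ι, StrictMono θ ∧ (∀ k, θ k ∈ U) ∧
        ε' ≤ 𝔼 x ∈ Fintype.piFinset P,
          edgeInd H (pairStar (θ 0) (θ 1) fun k : Fin r => θ k.succ.succ) x := by
  obtain ⟨ε', hε', K, hK⟩ := exists_large_inter r hε
  refine ⟨ε', hε', K + 2, ?_⟩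
  intro ι V _ _ _ H P U hP hU hT
  have hU0 : U.Nonempty := card_pos.1 (by lia)
  set i := U.min' hU0 with hi
  have hiU : i ∈ U := U.min'_mem hU0
  have hc1 : #(U.erase i) = K + 1 := by rw [card_erase_of_mem hiU]; lia
  have hU1 : (U.erase i).Nonempty := card_pos.1 (by lia)
  set j := (U.erase i).min' hU1 with hj
  have hjU : j ∈ U.erase i := (U.erase i).min'_mem hU1
  have hc2 : #((U.erase i).erase j) = K := by rw [card_erase_of_mem hjU]; lia
  have hlt1 : ∀ k ∈ U.erase i, i < k := fun k hk => U.min'_lt_of_mem_erase_min' hU0 hk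
  have hlt2 : ∀ k ∈ (U.erase i).erase j, j < k :=
    fun k hk => (U.erase i).min'_lt_of_mem_erase_min' hU1 hk
  obtain ⟨R, hR, hRc, hprob⟩ := hK ι (ι → V) (Fintype.piFinset P) ((U.erase i).erase j)
    (fun k x => ({i, j, k} : Finset ι).image x ∈ H.edges) (Fintype.piFinset_nonempty.2 hP) hc2.ge
    (by
      intro k hk
      have hkU : k ∈ U.erase i := mem_of_mem_erase hk
      refine (hT {i, j, k} ?_ ?_).trans (le_of_eq ?_)
      · simp [insert_subset_iff, hiU, mem_of_mem_erase hjU, mem_of_mem_erase hkU]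
      · exact card_eq_three.2 ⟨i, j, k, (hlt1 j hjU).ne, (hlt1 k hkU).ne, (hlt2 k hk).ne, rfl⟩
      · rw [expect_edgeInd]
        simp)
  have hz : ∀ k, R.orderEmbOfFin hRc k ∈ (U.erase i).erase j :=
    fun k => hR (R.orderEmbOfFin_mem hRc k)
  refine ⟨Fin.cons i (Fin.cons j (R.orderEmbOfFin hRc)), strictMono_cons (fun k => ?_)
    (strictMono_cons (fun k => hlt2 _ (hz k)) (R.orderEmbOfFin hRc).strictMono), fun k => ?_, ?_⟩
  · induction k using Fin.cases with
    | zero => exact hlt1 j hjU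
    | succ k => exact hlt1 _ (mem_of_mem_erase (hz k))
  · induction k using Fin.cases with
    | zero => exact hiU
    | succ k =>
      induction k using Fin.cases with
      | zero => exact mem_of_mem_erase hjU
      | succ k => exact mem_of_mem_erase (mem_of_mem_erase (hz k))
  · refine hprob.trans (le_of_eq ?_)
    rw [expect_edgeInd]
    refine prob_congr fun x _ => ?_
    simp only [pairStar, mem_image, mem_univ, true_and, forall_exists_index,
      forall_apply_eq_imp_iff]
    constructor
    · intro h k
      exact h _ (R.orderEmbOfFin_mem hRc k)
    · intro h k hk
      obtain ⟨l, rfl⟩ : k ∈ Set.range (R.orderEmbOfFin hRc) := by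
        rwa [range_orderEmbOfFin]
      exact h l

theorem pairStar_subset {ι : Type} [DecidableEq ι] {r : ℕ} (z : Fin r → ι) (i j : ι) :
    ∀ e ∈ pairStar i j z, e ⊆ {i, j} ∪ univ.image z := by
  intro e he
  obtain ⟨k, -, rfl⟩ := mem_image.1 he
  simp [insert_subset_iff]

section PairStars

variable {ι V : Type} [Fintype ι] [LinearOrder ι] [DecidableEq V]

/-- The probability that `x` becomes a simultaneous extension of the pair `i, j` once the
coordinates in the range of `z` are resampled. -/
noncomputable def starDensity {r : ℕ} (H : ThreeGraph V) (P : ι → Finset V) (z : Fin r → ι)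
    (l : ι × ι) (x : ι → V) : ℝ :=
  𝔼 y ∈ Fintype.piFinset P, edgeInd H (pairStar l.1 l.2 z) ((univ.image z).piecewise y x)

theorem starDensity_dependsOn {r : ℕ} (H : ThreeGraph V) (P : ι → Finset V) (z : Fin r → ι)
    (l : ι × ι) : DependsOn (starDensity H P z l) (({l.1, l.2} : Finset ι) : Set ι) := by
  intro x x' h
  refine expect_congr rfl fun y _ => ?_
  refine edgeInd_dependsOn H _ _ (pairStar_subset z l.1 l.2) fun i hi => ?_
  by_cases hz : i ∈ univ.image z
  · rw [piecewise_eq_of_mem _ _ _ hz, piecewise_eq_of_mem _ _ _ hz]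
  · rw [piecewise_eq_of_notMem _ _ _ hz, piecewise_eq_of_notMem _ _ _ hz]
    refine h i ?_
    exact (mem_union.1 (mem_coe.1 hi)).resolve_right hz

theorem le_expect_prod_starDensity {r : ℕ} {H : ThreeGraph V} {P : ι → Finset V} {z : Fin r → ι}
    {ε δ : ℝ} (hP : ∀ i, (P i).Nonempty) (hε : 0 < ε) (hε1 : ε ≤ 1) (hδ : 0 < δ)
    (L : Finset (ι × ι)) (hL : ∀ l ∈ L, l.1 < l.2 ∧ ∀ k, l.2 < z k)
    (hd : ∀ l ∈ L, ε ≤ 𝔼 x ∈ Fintype.piFinset P, edgeInd H (pairStar l.1 l.2 z) x)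
    (hreg : ∀ l ∈ L, IsBoxRegular P (edgeInd H (pairStar l.1 l.2 z))
      (𝔼 x ∈ Fintype.piFinset P, edgeInd H (pairStar l.1 l.2 z) x) δ) :
    (ε / 2) ^ #L - #L * δ ≤ 𝔼 x ∈ Fintype.piFinset P,
      ∏ l ∈ L, if ε / 2 ≤ starDensity H P z l x then (1 : ℝ) else 0 := by
  have hΩ : (Fintype.piFinset P).Nonempty := Fintype.piFinset_nonempty.2 hP
  induction L using Finset.induction_on with
  | empty => simp [expect_const hΩ]
  | insert l L hl ih =>
    have ih := ih (fun l h => hL l (mem_insert_of_mem h)) (fun l h => hd l (mem_insert_of_mem h))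
      fun l h => hreg l (mem_insert_of_mem h)
    let G : ι × ι → (ι → V) → ℝ := fun l x => if ε / 2 ≤ starDensity H P z l x then 1 else 0
    have hG : ∀ l x, 0 ≤ G l x ∧ G l x ≤ 1 := fun l x => by
      simp only [G]; split_ifs <;> norm_num
    have hGdep : ∀ l, DependsOn (G l) (({l.1, l.2} : Finset ι) : Set ι) := by
      intro l x x' h
      simp only [G, starDensity_dependsOn H P z l h]
    set Z := univ.image z
    have hll := hL l (mem_insert_self l L)
    have hnotZ : ∀ l' ∈ insert l L, l'.1 ∉ Z ∧ l'.2 ∉ Z := by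
      intro l' hl'
      obtain ⟨h1, h2⟩ := hL l' hl'
      simp only [Z, mem_image, mem_univ, true_and, not_exists]
      exact ⟨fun k hk => (h1.trans (h2 k)).ne' hk, fun k hk => (h2 k).ne' hk⟩
    have h1 := (hreg l (mem_insert_self l L)).le_expect_mul_prod hP (hd l (mem_insert_self l L))
      ({l.1, l.2} ∪ Z) (edgeInd_dependsOn H _ _ (pairStar_subset z l.1 l.2)) L
      (fun l => {l.1, l.2}) G (fun l _ => hG l) (fun l _ => hGdep l) (by
        intro l' hl'
        have hlt := (hL l' (mem_insert_of_mem hl')).1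
        have hZ := hnotZ l' (mem_insert_of_mem hl')
        have hne : l' ≠ l := fun h => hl (h ▸ hl')
        by_contra! hcon
        have hsub : ({l'.1, l'.2} : Finset ι) ∩ ({l.1, l.2} ∪ Z) = {l'.1, l'.2} :=
          eq_of_subset_of_card_le inter_subset_left (card_le_two.trans hcon)
        rw [inter_eq_left, insert_subset_iff, singleton_subset_iff] at hsub
        have ha := (mem_union.1 hsub.1).resolve_right hZ.1
        have hb := (mem_union.1 hsub.2).resolve_right hZ.2
        rw [mem_insert, mem_singleton] at ha hb
        apply hne
        rcases ha with ha | ha <;> rcases hb with hb | hb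
        · rw [ha, hb] at hlt; exact absurd hlt (lt_irrefl _)
        · exact Prod.ext ha hb
        · rw [ha, hb] at hlt; exact absurd hlt hll.1.not_gt
        · rw [ha, hb] at hlt; exact absurd hlt (lt_irrefl _))
    have h2 : 𝔼 x ∈ Fintype.piFinset P, edgeInd H (pairStar l.1 l.2 z) x * ∏ l ∈ L, G l x =
        𝔼 x ∈ Fintype.piFinset P, starDensity H P z l x * ∏ l ∈ L, G l x := by
      rw [← expect_piecewise P Z]
      refine expect_congr rfl fun x _ => ?_
      rw [starDensity, expect_mul]
      refine expect_congr rfl fun y _ => ?_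
      congr 1
      refine prod_congr rfl fun l' hl' => hGdep l' fun i hi => ?_
      refine piecewise_eq_of_notMem _ _ _ fun hiZ => ?_
      have hZ := hnotZ l' (mem_insert_of_mem hl')
      rw [mem_coe, mem_insert, mem_singleton] at hi
      rcases hi with rfl | rfl
      · exact hZ.1 hiZ
      · exact hZ.2 hiZ
    have h3 : 𝔼 x ∈ Fintype.piFinset P, starDensity H P z l x * ∏ l ∈ L, G l x ≤
        𝔼 x ∈ Fintype.piFinset P, (G l x * ∏ l ∈ L, G l x + ε / 2 * ∏ l ∈ L, G l x) := by
      refine expect_le_expect fun x _ => ?_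
      rw [← add_mul]
      refine mul_le_mul_of_nonneg_right ?_ (prod_nonneg fun l _ => (hG l x).1)
      simp only [G]
      split_ifs with h
      · have : starDensity H P z l x ≤ 1 := expect_le hΩ fun y _ => (edgeInd_mem _ _ _).2
        linarith
      · linarith
    rw [expect_add_distrib, ← mul_expect] at h3
    have h4 : 𝔼 x ∈ Fintype.piFinset P, ∏ l' ∈ insert l L,
        (if ε / 2 ≤ starDensity H P z l' x then (1 : ℝ) else 0) =
        𝔼 x ∈ Fintype.piFinset P, G l x * ∏ l ∈ L, G l x :=
      expect_congr rfl fun x _ => prod_insert hl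
    rw [h4, card_insert_of_notMem hl, pow_succ]
    have ih' : (ε / 2) ^ #L - #L * δ ≤ 𝔼 x ∈ Fintype.piFinset P, ∏ l ∈ L, G l x := ih
    have h5 := mul_le_mul_of_nonneg_left ih' (half_pos hε).le
    have h6 : ε / 2 * (#L * δ) ≤ 1 * (#L * δ) := by
      gcongr
      linarith
    push_cast
    linarith

/-- Independent choices of the top vertices turn the split systems of pairs into a copy of a
class of edges. -/
theorem le_expect_edgeInd_of_split {p : ℕ} {H : ThreeGraph V} {P : ι → Finset V} {j z : Fin p → ι}
    (hP : ∀ i, (P i).Nonempty) (hj : StrictMono j) (hz : StrictMono z) (hjz : ∀ k l, j k < z l)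
    {c' : ℝ} (hc' : 0 < c') (x : ι → V)
    (hsplit : ∀ A ⊆ univ.image j, c' ≤ prob (Fintype.piFinset P) fun y =>
      ∀ a ∈ A, ∀ b ∈ univ.image j \ A, a < b → ∀ e ∈ pairStar a b z,
        e.image ((univ.image z).piecewise y x) ∈ H.edges)
    (E : Finset (Finset (Fin p))) (f : Fin p → ℕ) (c : ℕ)
    (hE : ∀ e ∈ E, ∃ u v w, u < v ∧ v < w ∧ f v < c ∧ f u < c ∧ ¬ f w < c ∧ e = {u, v, w})
    (hO : ∀ t u v w, t < u → u < v → v < w → {t, u, w} ∈ E → {u, v, w} ∉ E) :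
    c' ^ p ≤ 𝔼 y ∈ Fintype.piFinset P,
      edgeInd H (E.image fun e => e.image fun q => if f q < c then j q else z q)
        ((univ.image z).piecewise y x) := by
  classical
  have hΩ : (Fintype.piFinset P).Nonempty := Fintype.piFinset_nonempty.2 hP
  set Z := univ.image z with hZ
  have hjZ : ∀ k, j k ∉ Z := by
    intro k
    simp only [Z, mem_image, mem_univ, true_and, not_exists]
    exact fun l hl => (hjz k l).ne' hl
  have hzZ : ∀ k, z k ∈ Z := fun k => mem_image_of_mem z (mem_univ k)
  let B : ι → V → Prop := fun i v => ∀ w, z w = i → ∀ a b, a < b → b < w → {a, b, w} ∈ E →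
    ({x (j a), x (j b), v} : Finset V) ∈ H.edges
  have h1 : ∀ i, (if i ∈ Z then c' else 1) ≤ 𝔼 v ∈ P i, if B i v then (1 : ℝ) else 0 := by
    intro i
    split_ifs with hi
    · obtain ⟨w, -, rfl⟩ := mem_image.1 hi
      refine (hsplit ((univ.filter fun a => ∃ b, a < b ∧ b < w ∧ {a, b, w} ∈ E).image j)
        (image_subset_image (subset_univ _))).trans ?_
      rw [← expect_apply_piFinset hP (z w) fun v => if B (z w) v then (1 : ℝ) else 0]
      have : prob (Fintype.piFinset P) (fun y => B (z w) (y (z w))) =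
          𝔼 y ∈ Fintype.piFinset P, if B (z w) (y (z w)) then (1 : ℝ) else 0 := by
        unfold prob
        refine expect_congr rfl fun y _ => ?_
        congr
      rw [← this]
      refine prob_mono fun y _ hy w' hw' a b hab hbw hE' => ?_
      obtain rfl := hz.injective hw'
      have := hy (j a) (mem_image_of_mem j (mem_filter.2 ⟨mem_univ _, b, hab, hbw, hE'⟩)) (j b) ?_
        (hj hab) {j a, j b, z w'} (mem_image_of_mem _ (mem_univ w'))
      · rwa [image_insert, image_insert, image_singleton, piecewise_eq_of_notMem _ _ _ (hjZ a),
          piecewise_eq_of_notMem _ _ _ (hjZ b), piecewise_eq_of_mem _ _ _ (hzZ w')] at this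
      · rw [mem_sdiff]
        refine ⟨mem_image_of_mem j (mem_univ b), fun hb => ?_⟩
        obtain ⟨b', hb', hbb⟩ := mem_image.1 hb
        obtain rfl := hj.injective hbb
        obtain ⟨-, d, hbd, hdw, hd⟩ := mem_filter.1 hb'
        exact hO a b' d w' hab hbd hdw hE' hd
    · have : ∀ v, B i v := fun v w hw => absurd (hw ▸ hzZ w) hi
      simp only [this, if_true]
      rw [expect_const (hP i)]
  have h2 : c' ^ p ≤ 𝔼 y ∈ Fintype.piFinset P, ∏ i, if B i (y i) then (1 : ℝ) else 0 := by
    rw [expect_prod_piFinset P fun i v => if B i v then (1 : ℝ) else 0]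
    refine le_trans (le_of_eq ?_) (prod_le_prod (fun i _ => ?_) fun i _ => h1 i)
    · rw [prod_ite_mem, univ_inter, prod_const, hZ, card_image_of_injective _ hz.injective,
        card_univ, Fintype.card_fin]
    · split_ifs <;> linarith
  refine h2.trans (expect_le_expect fun y _ => ?_)
  by_cases hB : ∀ i, B i (y i)
  swap
  · push Not at hB
    obtain ⟨i, hi⟩ := hB
    rw [prod_eq_zero (mem_univ i) (if_neg hi)]
    exact (edgeInd_mem _ _ _).1
  rw [edgeInd_eq_ite, if_pos]
  · exact prod_le_one (fun _ _ => by split_ifs <;> norm_num) fun _ _ => by split_ifs <;> norm_num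
  intro e' he'
  obtain ⟨e, he, rfl⟩ := mem_image.1 he'
  obtain ⟨u, v, w, huv, hvw, hv, hu, hw, rfl⟩ := hE e he
  have := hB (z w) w rfl u v huv hvw he
  simp only [image_insert, image_singleton, hu, hv, hw, if_true, if_false,
    piecewise_eq_of_notMem _ _ _ (hjZ u), piecewise_eq_of_notMem _ _ _ (hjZ v),
    piecewise_eq_of_mem _ _ _ (hzZ w)]
  exact this

end PairStars

/-- If all pairs below `z` are dense and regular, then a whole class of edges can be embedded. -/
theorem exists_dense_class (p : ℕ) {ε : ℝ} (hε : 0 < ε) (hε1 : ε ≤ 1) :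
    ∃ c₀ : ℝ, 0 < c₀ ∧ ∃ N : ℕ, ∃ δ : ℝ, 0 < δ ∧
      ∀ (ι V : Type) [Fintype ι] [LinearOrder ι] [DecidableEq V] (H : ThreeGraph V)
        (P : ι → Finset V) (X : Finset ι) (z : Fin p → ι) (E : Finset (Finset (Fin p)))
        (f : Fin p → ℕ) (c : ℕ),
        (∀ i, (P i).Nonempty) → #X = N → StrictMono z → (∀ i ∈ X, ∀ k, i < z k) →
        (∀ i ∈ X, ∀ j ∈ X, i < j →
          ε ≤ 𝔼 x ∈ Fintype.piFinset P, edgeInd H (pairStar i j z) x) →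
        (∀ i ∈ X, ∀ j ∈ X, i < j → IsBoxRegular P (edgeInd H (pairStar i j z))
          (𝔼 x ∈ Fintype.piFinset P, edgeInd H (pairStar i j z) x) δ) →
        Monotone f →
        (∀ e ∈ E, ∃ u v w, u < v ∧ v < w ∧ f v < c ∧ f u < c ∧ ¬ f w < c ∧ e = {u, v, w}) →
        (∀ t u v w, t < u → u < v → v < w → {t, u, w} ∈ E → {u, v, w} ∉ E) →
        ∃ θ : Fin p → ι, StrictMono θ ∧ (∀ q, θ q ∈ X ∪ univ.image z) ∧
          c₀ ≤ 𝔼 x ∈ Fintype.piFinset P, edgeInd H (E.image fun e => e.image θ) x := by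
  obtain ⟨c', hc', N, hN⟩ := exists_half_system p 1 (ε / 2) (half_pos hε)
  set ε₂ := (ε / 2) ^ (N * N) / 2 with hε₂
  have hε₂0 : 0 < ε₂ := by positivity
  refine ⟨c' ^ p * ε₂ / ((N : ℝ) ^ p + 1), by positivity, N, ε₂ / (N * N + 1), by positivity, ?_⟩
  intro ι V _ _ _ H P X z E f c hP hX hz hXz hd hreg hf hE hO
  classical
  have hΩ : (Fintype.piFinset P).Nonempty := Fintype.piFinset_nonempty.2 hP
  let L := (X ×ˢ X).filter fun l => l.1 < l.2
  have hLm : ∀ l, l ∈ L ↔ (l.1 ∈ X ∧ l.2 ∈ X) ∧ l.1 < l.2 := fun l => by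
    simp only [L, mem_filter, mem_product]
  have hLc : #L ≤ N * N := by
    rw [← hX, ← card_product]
    exact card_filter_le _ _
  let G : (ι → V) → ℝ := fun x =>
    ∏ l ∈ L, if ε / 2 ≤ starDensity H P z l x then (1 : ℝ) else 0
  have hG : ε₂ ≤ 𝔼 x ∈ Fintype.piFinset P, G x := by
    have h1 := le_expect_prod_starDensity (H := H) (P := P) (z := z) hP hε hε1
      (show 0 < ε₂ / (N * N + 1) by positivity) L
      (fun l hl => ⟨((hLm l).1 hl).2, hXz _ ((hLm l).1 hl).1.2⟩)
      (fun l hl => hd _ ((hLm l).1 hl).1.1 _ ((hLm l).1 hl).1.2 ((hLm l).1 hl).2)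
      (fun l hl => hreg _ ((hLm l).1 hl).1.1 _ ((hLm l).1 hl).1.2 ((hLm l).1 hl).2)
    refine le_trans ?_ h1
    have h2 : (ε / 2) ^ (N * N) ≤ (ε / 2) ^ #L :=
      pow_le_pow_of_le_one (half_pos hε).le (by linarith) hLc
    have h3 : (#L : ℝ) * (ε₂ / (N * N + 1)) ≤ ε₂ := by
      rw [mul_div_assoc', div_le_iff₀ (by positivity), mul_comm]
      have : (#L : ℝ) ≤ N * N := by exact_mod_cast hLc
      gcongr
      linarith
    linarith
  let J := (Fintype.piFinset fun _ : Fin p => X).filter fun j => StrictMono j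
  have hJc : (#J : ℝ) ≤ (N : ℝ) ^ p := by
    have : #J ≤ N ^ p := (card_filter_le _ _).trans (by simp [Fintype.card_piFinset, hX])
    exact_mod_cast this
  let θ : (Fin p → ι) → Fin p → ι := fun j q => if f q < c then j q else z q
  have hx : ∀ x, c' ^ p * G x ≤ ∑ j ∈ J, 𝔼 y ∈ Fintype.piFinset P,
      edgeInd H (E.image fun e => e.image (θ j)) ((univ.image z).piecewise y x) := by
    intro x
    have hnn : ∀ j ∈ J, 0 ≤ 𝔼 y ∈ Fintype.piFinset P,
        edgeInd H (E.image fun e => e.image (θ j)) ((univ.image z).piecewise y x) :=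
      fun j _ => expect_nonneg fun y _ => (edgeInd_mem _ _ _).1
    by_cases hall : ∀ l ∈ L, ε / 2 ≤ starDensity H P z l x
    swap
    · push Not at hall
      obtain ⟨l, hl, hl'⟩ := hall
      have : G x = 0 := prod_eq_zero hl (if_neg hl'.not_ge)
      rw [this, mul_zero]
      exact sum_nonneg hnn
    have hG1 : G x = 1 := prod_eq_one fun l hl => if_pos (hall l hl)
    obtain ⟨I, hI, hIc, l, -, r, -, -, -, hA⟩ := hN Unit ι (ι → V) (Fintype.piFinset P) X
      (fun _ a b y => ∀ e ∈ pairStar a b z, e.image ((univ.image z).piecewise y x) ∈ H.edges)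
      hΩ (by simp) hX.ge (by
        intro _ i hi j hj hij
        refine (hall (i, j) ((hLm _).2 ⟨⟨hi, hj⟩, hij⟩)).trans (le_of_eq ?_)
        unfold starDensity prob
        refine expect_congr rfl fun y _ => ?_
        rw [edgeInd_eq_ite]
        congr)
    have hIj : univ.image (I.orderEmbOfFin hIc) = I := by
      apply coe_injective
      rw [coe_image, coe_univ, Set.image_univ, range_orderEmbOfFin]
    have hjX : ∀ k, I.orderEmbOfFin hIc k ∈ X := fun k => hI (I.orderEmbOfFin_mem hIc k)
    have key := le_expect_edgeInd_of_split (H := H) hP (I.orderEmbOfFin hIc).strictMono hz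
      (fun k l => hXz _ (hjX k) l) hc' x (by
        rw [hIj]
        intro A hAI
        refine (hA () A hAI).trans (prob_mono fun y _ hy a ha b hb hab => ?_)
        exact hy a (mem_insert_of_mem ha) b (mem_insert_of_mem hb) hab) E f c hE hO
    rw [hG1, mul_one]
    have hmem : ⇑(I.orderEmbOfFin hIc) ∈ J :=
      mem_filter.2 ⟨Fintype.mem_piFinset.2 hjX, (I.orderEmbOfFin hIc).strictMono⟩
    exact key.trans (single_le_sum hnn hmem)
  have hsum : c' ^ p * ε₂ ≤ ∑ j ∈ J, 𝔼 x ∈ Fintype.piFinset P,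
      edgeInd H (E.image fun e => e.image (θ j)) x := by
    calc c' ^ p * ε₂ ≤ c' ^ p * 𝔼 x ∈ Fintype.piFinset P, G x := by gcongr
      _ = 𝔼 x ∈ Fintype.piFinset P, c' ^ p * G x := by rw [mul_expect]
      _ ≤ 𝔼 x ∈ Fintype.piFinset P, ∑ j ∈ J, 𝔼 y ∈ Fintype.piFinset P,
          edgeInd H (E.image fun e => e.image (θ j)) ((univ.image z).piecewise y x) :=
        expect_le_expect fun x _ => hx x
      _ = _ := by
        rw [expect_sum_comm]
        exact sum_congr rfl fun j _ => expect_piecewise P (univ.image z) _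
  obtain ⟨j, hj, hjd⟩ : ∃ j ∈ J, c' ^ p * ε₂ / ((N : ℝ) ^ p + 1) ≤
      𝔼 x ∈ Fintype.piFinset P, edgeInd H (E.image fun e => e.image (θ j)) x := by
    by_contra! hcon
    have h1 := hsum.trans (sum_le_sum fun j hj => (hcon j hj).le)
    rw [sum_const, nsmul_eq_mul] at h1
    have h2 : 0 < c' ^ p * ε₂ / ((N : ℝ) ^ p + 1) := by positivity
    have h3 := mul_le_mul_of_nonneg_right hJc h2.le
    have h4 : c' ^ p * ε₂ = ((N : ℝ) ^ p + 1) * (c' ^ p * ε₂ / ((N : ℝ) ^ p + 1)) :=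
      (mul_div_cancel₀ _ (by positivity)).symm
    linarith
  obtain ⟨hjX, hjm⟩ := mem_filter.1 hj
  rw [Fintype.mem_piFinset] at hjX
  refine ⟨θ j, ?_, fun q => ?_, hjd⟩
  · intro q q' hqq
    have := hf hqq.le
    dsimp only [θ]
    split_ifs with h1 h2 h2
    · exact hjm hqq
    · exact hXz _ (hjX q) q'
    · exact absurd (this.trans_lt h2) h1
    · exact hz hqq
  · dsimp only [θ]
    split_ifs
    · exact mem_union_left _ (hjX q)
    · exact mem_union_right _ (mem_image_of_mem z (mem_univ q))

theorem IsBoxRegular.mono {ι V : Type} [Fintype ι] [DecidableEq ι] {P : ι → Finset V}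
    {Q : (ι → V) → ℝ} {t δ δ' : ℝ} (h : IsBoxRegular P Q t δ) (hδ : δ ≤ δ') :
    IsBoxRegular P Q t δ' :=
  fun w hw => (h w hw).trans hδ

/-- Regular classes of edges that pairwise interact in few vertices occur simultaneously. -/
theorem le_expect_prod_classes {ι V : Type} [Fintype ι] [DecidableEq ι] [DecidableEq V] {p : ℕ}
    {H : ThreeGraph V} {P : ι → Finset V} (hP : ∀ i, (P i).Nonempty) {θ : Fin p → ι}
    (hθ : Function.Injective θ) (E : Finset (Finset (Fin p))) (f : Fin p → ℕ) (key : ℕ → ℕ)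
    (hkey : ∀ c c', c ≠ c' → key c' ≤ key c → ∀ e ∈ E, e.sup f = c' → ∀ u ∈ e, ∀ v ∈ e,
      ∀ e₁ ∈ E, ∀ e₂ ∈ E, e₁.sup f = c → e₂.sup f = c → u ∈ e₁ → v ∈ e₂ → u = v)
    {c₀ δ : ℝ} (hc₀ : 0 < c₀) (hc₁ : c₀ ≤ 1) (hδ : 0 < δ) (C : Finset ℕ)
    (hd : ∀ c ∈ C, c₀ ≤ 𝔼 x ∈ Fintype.piFinset P,
      edgeInd H ((E.filter fun e => e.sup f = c).image fun e => e.image θ) x)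
    (hreg : ∀ A : Finset (Finset ι), IsBoxRegular P (edgeInd H A)
      (𝔼 x ∈ Fintype.piFinset P, edgeInd H A x) δ) :
    c₀ ^ #C - #C * δ ≤ 𝔼 x ∈ Fintype.piFinset P, ∏ e ∈ E.filter (fun e => e.sup f ∈ C),
      if (e.image θ).image x ∈ H.edges then (1 : ℝ) else 0 := by
  have hΩ : (Fintype.piFinset P).Nonempty := Fintype.piFinset_nonempty.2 hP
  induction C using Finset.induction_on_max_value key with
  | empty => simp [expect_const hΩ]
  | insert c C hc hmax ih =>
    have ih := ih fun c h => hd c (mem_insert_of_mem h)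
    let g : Finset (Fin p) → (ι → V) → ℝ := fun e x =>
      if (e.image θ).image x ∈ H.edges then (1 : ℝ) else 0
    have hg : ∀ e x, 0 ≤ g e x ∧ g e x ≤ 1 := fun e x => by
      simp only [g]; split_ifs <;> norm_num
    have hinj : Function.Injective fun e : Finset (Fin p) => e.image θ :=
      fun _ _ h => image_injective hθ h
    have hdc := hd c (mem_insert_self c C)
    obtain ⟨A, hA⟩ : ∃ A, A = (E.filter fun e => e.sup f = c).image fun e => e.image θ := ⟨_, rfl⟩
    rw [← hA] at hdc
    have h1 := (hreg A).le_expect_mul_prod hP hdc (A.biUnion id)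
      (edgeInd_dependsOn H _ _ fun e he => subset_biUnion_of_mem id he)
      (E.filter fun e => e.sup f ∈ C) (fun e => e.image θ) g (fun e _ => hg e)
      (by
        intro e _ x y hxy
        simp only [g]
        rw [image_congr fun i hi => hxy i hi])
      (by
        intro e he
        obtain ⟨heE, heC⟩ := mem_filter.1 he
        have hmem : ∀ u, θ u ∈ A.biUnion id → ∃ e₁ ∈ E, e₁.sup f = c ∧ u ∈ e₁ := by
          intro u hu
          obtain ⟨e', he', hue⟩ := mem_biUnion.1 hu
          obtain ⟨e₁, he₁, rfl⟩ := mem_image.1 (hA ▸ he')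
          obtain ⟨v, hv, hvu⟩ := mem_image.1 hue
          obtain ⟨ha, hb⟩ := mem_filter.1 he₁
          exact ⟨e₁, ha, hb, hθ hvu ▸ hv⟩
        rw [card_le_one]
        intro a ha b hb
        rw [mem_inter, mem_image] at ha hb
        obtain ⟨⟨u, hu, rfl⟩, hus⟩ := ha
        obtain ⟨⟨v, hv, rfl⟩, hvs⟩ := hb
        obtain ⟨e₁, he₁, hc1, hu1⟩ := hmem u hus
        obtain ⟨e₂, he₂, hc2, hv2⟩ := hmem v hvs
        rw [hkey c (e.sup f) (fun h => hc (h ▸ heC)) (hmax _ heC) e heE rfl u hu v hv e₁ he₁ e₂ he₂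
          hc1 hc2 hu1 hv2])
    have h2 : ∀ x, ∏ e ∈ E.filter (fun e => e.sup f ∈ insert c C), g e x =
        edgeInd H A x *
          ∏ e ∈ E.filter (fun e => e.sup f ∈ C), g e x := by
      intro x
      rw [edgeInd, hA, prod_image hinj.injOn, ← prod_union]
      · rw [← filter_or]
        simp only [mem_insert, g]
      · rw [disjoint_filter]
        intro e _ h1 h2
        exact hc (h1 ▸ h2)
    have h3 : 𝔼 x ∈ Fintype.piFinset P, ∏ e ∈ E.filter (fun e => e.sup f ∈ insert c C), g e x =
        𝔼 x ∈ Fintype.piFinset P,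
          edgeInd H A x *
          ∏ e ∈ E.filter (fun e => e.sup f ∈ C), g e x := expect_congr rfl fun x _ => h2 x
    rw [h3, card_insert_of_notMem hc, pow_succ]
    refine le_trans ?_ h1
    have h4 := mul_le_mul_of_nonneg_left ih hc₀.le
    have h5 : c₀ * (#C * δ) ≤ 1 * (#C * δ) := by gcongr
    have h6 : c₀ * (𝔼 x ∈ Fintype.piFinset P, ∏ e ∈ E.filter (fun e => e.sup f ∈ C),
      if (e.image θ).image x ∈ H.edges then (1 : ℝ) else 0) = c₀ * (𝔼 x ∈ Fintype.piFinset P,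
        ∏ e ∈ E.filter (fun e => e.sup f ∈ C), g e x) := rfl
    push_cast
    linarith

theorem exists_disjoint_parts {N n : ℕ} (hN : 0 < N) (hn : N ≤ n) :
    ∃ P : Fin N → Finset (Fin n), (∀ i j v, v ∈ P i → v ∈ P j → i = j) ∧ (∀ i, (P i).Nonempty) ∧
      ∀ i, (n : ℝ) / (2 * N) ≤ #(P i) := by
  have hlt : ∀ (i : Fin N) (k : Fin (n / N)), i.1 + N * k.1 < n := by
    intro i k
    have h1 : N * (k.1 + 1) ≤ N * (n / N) := Nat.mul_le_mul_left N k.2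
    have h2 := Nat.mul_div_le n N
    have h3 := i.2
    rw [Nat.mul_add_one] at h1
    lia
  have hcard : ∀ i : Fin N,
      #(univ.image fun k : Fin (n / N) => (⟨i.1 + N * k.1, hlt i k⟩ : Fin n)) =
      n / N := by
    intro i
    rw [card_image_of_injective, card_univ, Fintype.card_fin]
    intro k l h
    have h' : i.1 + N * k.1 = i.1 + N * l.1 := congrArg Fin.val h
    exact Fin.ext (Nat.eq_of_mul_eq_mul_left hN (by lia))
  have hpos : 0 < n / N := Nat.div_pos hn hN
  refine ⟨fun i => univ.image fun k : Fin (n / N) => ⟨i.1 + N * k.1, hlt i k⟩, ?_, fun i => ?_,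
    fun i => ?_⟩
  · intro i j v hi hj
    obtain ⟨k, -, rfl⟩ := mem_image.1 hi
    obtain ⟨l, -, h⟩ := mem_image.1 hj
    have h' : j.1 + N * l.1 = i.1 + N * k.1 := congrArg Fin.val h
    have h2 := congrArg (· % N) h'
    simp only [Nat.add_mul_mod_self_left, Nat.mod_eq_of_lt i.2, Nat.mod_eq_of_lt j.2] at h2
    exact Fin.ext h2.symm
  · rw [← card_pos, hcard]
    exact hpos
  · rw [hcard, div_le_iff₀ (by positivity)]
    have h1 : n < N * (n / N + 1) := Nat.lt_mul_div_succ n hN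
    have h2 : n ≤ n / N * (2 * N) := by nlinarith
    exact_mod_cast h2

/-- Suitably ordered 3-graphs occur in every uniformly dense 3-graph of positive density. -/
theorem exists_copy_of_ordered {p : ℕ} (E : Finset (Finset (Fin p))) (f : Fin p → ℕ)
    (hf : Monotone f) (hE : ∀ e ∈ E, ∃ u v w, u < v ∧ v < w ∧ f v < f w ∧ e = {u, v, w})
    (hO : ∀ t u v w, t < u → u < v → v < w → {t, u, w} ∈ E → {u, v, w} ∉ E) (key : ℕ → ℕ)
    (hkey : ∀ c c', c ≠ c' → key c' ≤ key c → ∀ e ∈ E, e.sup f = c' → ∀ u ∈ e, ∀ v ∈ e,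
      ∀ e₁ ∈ E, ∀ e₂ ∈ E, e₁.sup f = c → e₂.sup f = c → u ∈ e₁ → v ∈ e₂ → u = v)
    {d : ℝ} (hd : 0 < d) :
    ∃ η : ℝ, 0 < η ∧ ∃ n₀ : ℕ, ∀ (n : ℕ) (H : ThreeGraph (Fin n)), n₀ ≤ n →
      UniformlyDense H d η →
      ∃ φ : Fin p → Fin n, Function.Injective φ ∧ ∀ e ∈ E, e.image φ ∈ H.edges := by
  classical
  obtain ⟨m₀, ε₀, hε₀, htriple⟩ := exists_dense_triple hd
  obtain ⟨ε₁', hε₁', m₁, hstar⟩ := exists_dense_star p hε₀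
  set ε₁ := min ε₁' 1 with hε₁
  have hε₁0 : 0 < ε₁ := lt_min hε₁' one_pos
  obtain ⟨c₁, hc₁, N₁, δ₁, hδ₁, hclass⟩ := exists_dense_class p hε₁0 (min_le_right _ _)
  set c₀ := min c₁ 1
  have hc₀ : 0 < c₀ := lt_min hc₁ one_pos
  set C := E.image fun e => e.sup f with hC
  set δ := min δ₁ (c₀ ^ #C / (#C + 1)) with hδ
  have hδ0 : 0 < δ := lt_min hδ₁ (by positivity)
  obtain ⟨N₃, hN₃⟩ := ramsey_tuple p (N₁ + p) p #C
  obtain ⟨N₂, hN₂⟩ := ramsey_tuple (p + 2) m₁ N₃ 1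
  obtain ⟨N', hN'⟩ := ramsey_good 3 m₀ N₂
  set N := N' + 1 with hN
  obtain ⟨γ, hγ, hbox⟩ := exists_regular_subbox_family (Fin N)
    #(univ : Finset (Finset (Finset (Fin N)))) (δ / 2) (half_pos hδ0)
  have hN0 : (0 : ℝ) < N := by positivity
  obtain ⟨η, hη, n₁, hn₁⟩ := htriple (γ / (2 * N)) (by positivity)
  refine ⟨η, hη, max n₁ N, fun n H hn hH => ?_⟩
  obtain ⟨P₀, hdisj, hne₀, hlarge⟩ := exists_disjoint_parts (N := N) (by lia)
    ((le_max_right _ _).trans hn)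
  obtain ⟨P, hsub, hP, hPγ, hreg⟩ := hbox (Fin n) (Finset (Finset (Fin N))) univ P₀
    (fun A => edgeInd H A) rfl hne₀ (fun A x => edgeInd_mem H A x)
  have hreg : ∀ A : Finset (Finset (Fin N)), IsBoxRegular P (edgeInd H A)
      (𝔼 x ∈ Fintype.piFinset P, edgeInd H A x) δ := by
    intro A
    obtain ⟨t, ht⟩ := hreg A (mem_univ A)
    have := ht.mean hP
    rwa [mul_div_cancel₀ δ two_ne_zero] at this
  have htr := hn₁ (Fin N) n H P ((le_max_left _ _).trans hn) hH (by
    intro i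
    refine le_trans ?_ (hPγ i)
    calc γ / (2 * N) * n = γ * (n / (2 * N)) := by ring
      _ ≤ γ * #(P₀ i) := by gcongr; exact hlarge i) hP
  obtain ⟨T₁, -, hT₁c, hT₁⟩ := hN' (Fin N) univ
    (fun R => ε₀ ≤ 𝔼 x ∈ Fintype.piFinset P, edgeInd H {R} x)
    (by rw [card_univ, Fintype.card_fin]; lia) (fun U _ hU => htr U hU)
  obtain ⟨T₂, hT₂s, hT₂c, hT₂⟩ := hN₂ (Fin N) Unit T₁
    (fun _ θ => ε₁ ≤ 𝔼 x ∈ Fintype.piFinset P,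
      edgeInd H (pairStar (θ 0) (θ 1) fun k : Fin p => θ k.succ.succ) x) (by simp) hT₁c.ge (by
      intro _ U hU hUc
      obtain ⟨θ, h1, h2, h3⟩ := hstar (Fin N) (Fin n) H P U hP hUc
        fun T hT hTc => hT₁ T (hT.trans hU) hTc
      exact ⟨θ, h1, h2, (min_le_left _ _).trans h3⟩)
  obtain ⟨T₃, hT₃s, hT₃c, hT₃⟩ := hN₃ (Fin N) {c // c ∈ C} T₂
    (fun c θ => c₀ ≤ 𝔼 x ∈ Fintype.piFinset P,
      edgeInd H ((E.filter fun e => e.sup f = c.1).image fun e => e.image θ) x) (by simp)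
      hT₂c.ge (by
      rintro ⟨c, hc⟩ U hU hUc
      let o := U.orderEmbOfFin hUc
      have hoU : ∀ k, o k ∈ U := U.orderEmbOfFin_mem hUc
      let X : Finset (Fin N) := univ.image fun k : Fin N₁ => o (Fin.castAdd p k)
      let z : Fin p → Fin N := fun k => o (Fin.natAdd N₁ k)
      have hXm : ∀ i ∈ X, ∃ k, o (Fin.castAdd p k) = i := fun i hi => by simpa [X] using hi
      have hz : StrictMono z := fun k l h => o.strictMono (by simpa using h)
      have hXz : ∀ i ∈ X, ∀ k, i < z k := by
        intro i hi k
        obtain ⟨l, rfl⟩ := hXm i hi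
        exact o.strictMono (Fin.lt_def.2 (by simp; lia))
      have hXU : X ⊆ U := fun i hi => by
        obtain ⟨l, rfl⟩ := hXm i hi
        exact hoU _
      obtain ⟨θ, h1, h2, h3⟩ := hclass (Fin N) (Fin n) H P X z (E.filter fun e => e.sup f = c) f c
        hP
        (by
          rw [card_image_of_injective, card_univ, Fintype.card_fin]
          exact o.injective.comp (Fin.castAdd_injective N₁ p)) hz hXz
        (by
          intro i hi j hj hij
          refine hT₂ () (Fin.cons i (Fin.cons j z)) (strictMono_cons (fun k => ?_)
            (strictMono_cons (hXz j hj) hz)) fun k => ?_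
          · induction k using Fin.cases with
            | zero => exact hij
            | succ k => exact hXz i hi k
          · induction k using Fin.cases with
            | zero => exact hU (hXU hi)
            | succ k =>
              induction k using Fin.cases with
              | zero => exact hU (hXU hj)
              | succ k => exact hU (hoU _))
        (fun i _ j _ _ => (hreg _).mono (min_le_left _ _)) hf
        (by
          intro e he
          obtain ⟨heE, hec⟩ := mem_filter.1 he
          obtain ⟨u, v, w, huv, hvw, hlt, rfl⟩ := hE e heE
          have hu := (hf huv.le).trans_lt hlt
          have hw : f w = c := by
            rw [← hec]
            simp [hlt.le, hu.le]
          exact ⟨u, v, w, huv, hvw, hw ▸ hlt, hw ▸ hu, by simp [hw], rfl⟩)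
        (fun t u v w h1 h2 h3 h4 h5 =>
          hO t u v w h1 h2 h3 (mem_of_mem_filter _ h4) (mem_of_mem_filter _ h5))
      refine ⟨θ, h1, fun q => ?_, (min_le_left _ _).trans h3⟩
      rcases mem_union.1 (h2 q) with h | h
      · exact hXU h
      · obtain ⟨k, -, hk⟩ := mem_image.1 h
        exact hk ▸ hoU _)
  let θ := T₃.orderEmbOfFin hT₃c
  have hθ : Function.Injective θ := θ.injective
  have hfin := le_expect_prod_classes hP hθ E f key hkey hc₀ (min_le_right _ _) hδ0 C
    (fun c hc => hT₃ ⟨c, hc⟩ θ θ.strictMono (T₃.orderEmbOfFin_mem hT₃c)) hreg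
  have hpos : 0 < c₀ ^ #C - #C * δ := by
    have h1 : δ ≤ c₀ ^ #C / (#C + 1) := min_le_right _ _
    rw [le_div_iff₀ (by positivity)] at h1
    linarith
  obtain ⟨x, hx, hx0⟩ := exists_ne_zero_of_expect_ne_zero (hpos.trans_le hfin).ne'
  refine ⟨x ∘ θ, fun a b hab => hθ (hdisj _ _ _ (hsub _ (Fintype.mem_piFinset.1 hx (θ a))) ?_),
    fun e he => ?_⟩
  · have h1 := hsub _ (Fintype.mem_piFinset.1 hx (θ b))
    rwa [← show x (θ a) = x (θ b) from hab] at h1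
  · have h1 := prod_ne_zero_iff.1 hx0 e (mem_filter.2 ⟨he, mem_image_of_mem _ he⟩)
    rw [← image_image]
    by_contra h
    exact h1 (if_neg h)

section CutNorm

variable {V : Type} [Fintype V]

theorem sq_sum_mul_mul_le {D : V → V → ℝ} {B : ℝ} (hB : ∑ x, ∑ x', |∑ y, D x y * D x' y| ≤ B)
    {g h : V → ℝ} (hg : ∀ x, |g x| ≤ 1) (hh : ∀ x, |h x| ≤ 1) :
    (∑ x, ∑ y, g x * h y * D x y) ^ 2 ≤ Fintype.card V * B := by
  have h1 : ∑ x, ∑ y, g x * h y * D x y = ∑ y, h y * ∑ x, g x * D x y := by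
    rw [sum_comm]
    refine sum_congr rfl fun y _ => ?_
    rw [mul_sum]
    exact sum_congr rfl fun x _ => by ring
  have h2 : ∑ y, (∑ x, g x * D x y) ^ 2 ≤ B := by
    refine le_trans ?_ hB
    have h3 : ∑ y, (∑ x, g x * D x y) ^ 2 = ∑ x, ∑ x', g x * g x' * ∑ y, D x y * D x' y := by
      simp only [sq, sum_mul_sum]
      rw [sum_comm]
      refine sum_congr rfl fun x _ => ?_
      rw [sum_comm]
      refine sum_congr rfl fun x' _ => ?_
      rw [mul_sum]
      exact sum_congr rfl fun y _ => by ring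
    rw [h3]
    refine sum_le_sum fun x _ => sum_le_sum fun x' _ => (le_abs_self _).trans ?_
    rw [abs_mul, abs_mul]
    exact mul_le_of_le_one_left (abs_nonneg _) (mul_le_one₀ (hg x) (abs_nonneg _) (hg x'))
  have h3 : ∑ y, h y ^ 2 ≤ Fintype.card V := by
    calc ∑ y, h y ^ 2 ≤ ∑ _y : V, (1 : ℝ) :=
          sum_le_sum fun y _ => by rw [sq_le_one_iff_abs_le_one]; exact hh y
      _ = _ := by simp
  rw [h1]
  refine (sum_mul_sq_le_sq_mul_sq univ h fun y => ∑ x, g x * D x y).trans ?_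
  exact mul_le_mul h3 h2 (sum_nonneg fun _ _ => sq_nonneg _) (Nat.cast_nonneg _)

theorem le_sum_triples_of_cut {A₀ A₁ A₂ L : V → V → ℝ} {ρ : ℝ}
    (hA₁ : ∀ x y, 0 ≤ A₁ x y ∧ A₁ x y ≤ 1) (hA₂ : ∀ x y, 0 ≤ A₂ x y ∧ A₂ x y ≤ 1)
    (hL : ∀ x y, 0 ≤ L x y ∧ L x y ≤ 1)
    (hcut : ∀ A ∈ ({A₀, A₁, A₂} : Set (V → V → ℝ)), ∀ g h : V → ℝ, (∀ x, 0 ≤ g x ∧ g x ≤ 1) →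
      (∀ x, 0 ≤ h x ∧ h x ≤ 1) → |∑ x, ∑ y, g x * h y * (A x y - L x y / 3)| ≤ ρ)
    {u : V → ℝ} (hu : ∀ x, 0 ≤ u x ∧ u x ≤ 1) :
    1 / 27 * (∑ x, ∑ y, ∑ z, u x * u y * u z * (L x y * L x z * L y z)) - 3 * Fintype.card V * ρ ≤
      ∑ x, ∑ y, ∑ z, u x * u y * u z * (A₀ x y * A₁ x z * A₂ y z) := by
  have mul_mem : ∀ {a b : ℝ}, 0 ≤ a ∧ a ≤ 1 → 0 ≤ b ∧ b ≤ 1 → 0 ≤ a * b ∧ a * b ≤ 1 :=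
    fun ha hb => ⟨mul_nonneg ha.1 hb.1, mul_le_one₀ ha.2 hb.1 hb.2⟩
  have bound : ∀ s : V → ℝ, (∀ v, |s v| ≤ ρ) → - (Fintype.card V * ρ) ≤ ∑ v, u v * s v := by
    intro s hs
    have : ∑ v : V, -ρ ≤ ∑ v, u v * s v := by
      refine sum_le_sum fun v _ => ?_
      have h1 : |u v * s v| ≤ ρ := by
        rw [abs_mul, abs_of_nonneg (hu v).1]
        exact (mul_le_of_le_one_left (abs_nonneg _) (hu v).2).trans (hs v)
      exact (abs_le.1 h1).1
    rw [sum_const, card_univ, nsmul_eq_mul] at this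
    linarith
  have h0 := bound (fun z => ∑ x, ∑ y, (u x * A₁ x z) * (u y * A₂ y z) * (A₀ x y - L x y / 3))
    fun z => hcut A₀ (by simp) _ _ (fun x => mul_mem (hu x) (hA₁ x z))
      fun y => mul_mem (hu y) (hA₂ y z)
  have h1 := bound (fun y => ∑ x, ∑ z, (u x * (L x y / 3)) * (u z * A₂ y z) *
      (A₁ x z - L x z / 3)) fun y => hcut A₁ (by simp) _ _
      (fun x => mul_mem (hu x) ⟨by linarith [hL x y], by linarith [hL x y]⟩)
      fun z => mul_mem (hu z) (hA₂ y z)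
  have h2 := bound (fun x => ∑ y, ∑ z, (u y * (L x y / 3)) * (u z * (L x z / 3)) *
      (A₂ y z - L y z / 3)) fun x => hcut A₂ (by simp) _ _
      (fun y => mul_mem (hu y) ⟨by linarith [hL x y], by linarith [hL x y]⟩)
      fun z => mul_mem (hu z) ⟨by linarith [hL x z], by linarith [hL x z]⟩
  simp only [mul_sum] at h0 h1 h2
  have e0 := (sum_comm (s := univ) (t := univ) (f := fun z x => ∑ y, u z *
    ((u x * A₁ x z) * (u y * A₂ y z) * (A₀ x y - L x y / 3)))).trans
    (sum_congr rfl fun x _ => sum_comm)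
  have e1 := sum_comm (s := univ) (t := univ) (f := fun y x => ∑ z, u y *
    ((u x * (L x y / 3)) * (u z * A₂ y z) * (A₁ x z - L x z / 3)))
  rw [e0] at h0
  rw [e1] at h1
  have key : ∑ x, ∑ y, ∑ z, u x * u y * u z * (A₀ x y * A₁ x z * A₂ y z) -
      1 / 27 * (∑ x, ∑ y, ∑ z, u x * u y * u z * (L x y * L x z * L y z)) =
      ∑ x, ∑ y, ∑ z, u z * ((u x * A₁ x z) * (u y * A₂ y z) * (A₀ x y - L x y / 3)) +
      ∑ x, ∑ y, ∑ z, u y * ((u x * (L x y / 3)) * (u z * A₂ y z) * (A₁ x z - L x z / 3)) +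
      ∑ x, ∑ y, ∑ z, u x *
        ((u y * (L x y / 3)) * (u z * (L x z / 3)) * (A₂ y z - L y z / 3)) := by
    simp only [mul_sum, ← sum_add_distrib, ← sum_sub_distrib]
    exact sum_congr rfl fun x _ => sum_congr rfl fun y _ => sum_congr rfl fun z _ => by ring
  linarith

end CutNorm

section Construction

/-- The deviation of a colour class from its expected density. -/
noncomputable def colourDev (c v : Fin 3) : ℝ := (if v = c then 1 else 0) - 1 / 3

theorem sum_colourDev (c : Fin 3) : ∑ v, colourDev c v = 0 := by
  simp [colourDev]

theorem abs_colourDev_le (c v : Fin 3) : |colourDev c v| ≤ 1 := by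
  rw [abs_le]
  unfold colourDev
  split_ifs <;> constructor <;> norm_num

theorem sum_colourDev_mul {k : ℕ} {s s' : Fin k} (h : s ≠ s') (c : Fin 3) :
    ∑ t : Fin k → Fin 3, colourDev c (t s) * colourDev c (t s') = 0 := by
  have h1 : ∀ t : Fin k → Fin 3, colourDev c (t s) * colourDev c (t s') =
      ∏ i, (if i = s then colourDev c (t i) else 1) *
        (if i = s' then colourDev c (t i) else 1) := by
    intro t
    rw [prod_mul_distrib, prod_ite_eq', prod_ite_eq', if_pos (mem_univ _), if_pos (mem_univ _)]
  simp only [h1]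
  rw [← Fintype.piFinset_univ, ← prod_univ_sum (fun _ => univ) fun i v =>
    (if i = s then colourDev c v else 1) * (if i = s' then colourDev c v else 1)]
  refine prod_eq_zero (mem_univ s) ?_
  simp only [if_true, h, if_false, mul_one]
  exact sum_colourDev c

variable {V : Type} [Fintype V] {M k : ℕ}

/-- The indicator of pairs in increasing blocks. -/
def blockLT (σ : V ≃ Fin M × Fin k × (Fin k → Fin 3)) (x y : V) : ℝ :=
  if (σ x).1 < (σ y).1 then 1 else 0

/-- The colour of a pair of vertices. -/
def pairColour (σ : V ≃ Fin M × Fin k × (Fin k → Fin 3)) (x y : V) : Fin 3 :=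
  (σ y).2.2 (σ x).2.1

theorem sum_blockLT_colourDev_mul (σ : V ≃ Fin M × Fin k × (Fin k → Fin 3)) (c : Fin 3) {x x' : V}
    (h : (σ x).2.1 ≠ (σ x').2.1) :
    ∑ y, (blockLT σ x y * colourDev c (pairColour σ x y)) *
      (blockLT σ x' y * colourDev c (pairColour σ x' y)) = 0 := by
  unfold blockLT pairColour
  rw [σ.sum_comp fun y => ((if (σ x).1 < y.1 then (1 : ℝ) else 0) *
    colourDev c (y.2.2 (σ x).2.1)) * ((if (σ x').1 < y.1 then 1 else 0) *
    colourDev c (y.2.2 (σ x').2.1)), Fintype.sum_prod_type]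
  refine sum_eq_zero fun b _ => ?_
  rw [Fintype.sum_prod_type]
  refine sum_eq_zero fun s _ => ?_
  have := sum_colourDev_mul h c
  calc _ = ∑ t : Fin k → Fin 3, ((if (σ x).1 < b then (1 : ℝ) else 0) *
        (if (σ x').1 < b then 1 else 0)) *
        (colourDev c (t (σ x).2.1) * colourDev c (t (σ x').2.1)) :=
        sum_congr rfl fun t _ => by ring
    _ = 0 := by rw [← mul_sum, this, mul_zero]

theorem card_index_eq (σ : V ≃ Fin M × Fin k × (Fin k → Fin 3)) (s : Fin k) :
    k * #{x : V | (σ x).2.1 = s} = Fintype.card V := by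
  have h1 : #{x : V | (σ x).2.1 = s} = M * 3 ^ k := by
    rw [← Fintype.card_subtype]
    have e : {x : V // (σ x).2.1 = s} ≃ Fin M × (Fin k → Fin 3) :=
      { toFun := fun x => ((σ x.1).1, (σ x.1).2.2)
        invFun := fun y => ⟨σ.symm (y.1, s, y.2), by simp⟩
        left_inv := fun x => by
          apply Subtype.ext
          simp only
          rw [Equiv.symm_apply_eq]
          simp [Prod.ext_iff, x.2]
        right_inv := fun y => by simp }
    rw [Fintype.card_congr e]
    simp
  rw [h1, Fintype.card_congr σ]
  simp
  ring

theorem card_block_eq (σ : V ≃ Fin M × Fin k × (Fin k → Fin 3)) (b : Fin M) :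
    M * #{x : V | b = (σ x).1} = Fintype.card V := by
  have h1 : #{x : V | b = (σ x).1} = k * 3 ^ k := by
    rw [← Fintype.card_subtype]
    have e : {x : V // b = (σ x).1} ≃ Fin k × (Fin k → Fin 3) :=
      { toFun := fun x => (σ x.1).2
        invFun := fun y => ⟨σ.symm (b, y), by simp⟩
        left_inv := fun x => by
          apply Subtype.ext
          simp only
          rw [Equiv.symm_apply_eq]
          simp [x.2]
        right_inv := fun y => by simp }
    rw [Fintype.card_congr e]
    simp
  rw [h1, Fintype.card_congr σ]
  simp

theorem colour_cut (σ : V ≃ Fin M × Fin k × (Fin k → Fin 3)) (hk : 0 < k) (c : Fin 3)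
    {g h : V → ℝ} (hg : ∀ x, 0 ≤ g x ∧ g x ≤ 1) (hh : ∀ x, 0 ≤ h x ∧ h x ≤ 1) :
    (∑ x, ∑ y, g x * h y * (blockLT σ x y * colourDev c (pairColour σ x y))) ^ 2 ≤
      (Fintype.card V : ℝ) ^ 4 / k := by
  have hk0 : (0 : ℝ) < k := by exact_mod_cast hk
  have habs : ∀ {a : ℝ}, 0 ≤ a ∧ a ≤ 1 → |a| ≤ 1 := fun h => abs_le.2 ⟨by linarith, h.2⟩
  have hD : ∀ x y, |blockLT σ x y * colourDev c (pairColour σ x y)| ≤ 1 := by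
    intro x y
    rw [abs_mul]
    refine mul_le_one₀ (habs ?_) (abs_nonneg _) (abs_colourDev_le _ _)
    unfold blockLT
    split_ifs <;> norm_num
  refine (sq_sum_mul_mul_le (B := (Fintype.card V : ℝ) ^ 3 / k) ?_ (fun x => habs (hg x))
    fun x => habs (hh x)).trans (le_of_eq (by ring))
  have h1 : ∀ x x', |∑ y, (blockLT σ x y * colourDev c (pairColour σ x y)) *
      (blockLT σ x' y * colourDev c (pairColour σ x' y))| ≤
      if (σ x').2.1 = (σ x).2.1 then (Fintype.card V : ℝ) else 0 := by
    intro x x'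
    split_ifs with hs
    · refine (abs_sum_le_sum_abs _ _).trans ?_
      calc _ ≤ ∑ _y : V, (1 : ℝ) := by
            refine sum_le_sum fun y _ => ?_
            rw [abs_mul]
            exact mul_le_one₀ (hD x y) (abs_nonneg _) (hD x' y)
        _ = _ := by simp
    · rw [sum_blockLT_colourDev_mul σ c (Ne.symm hs), abs_zero]
  refine (sum_le_sum fun x _ => sum_le_sum fun x' _ => h1 x x').trans (le_of_eq ?_)
  have h2 : ∀ x : V, ∑ x' : V, (if (σ x').2.1 = (σ x).2.1 then (Fintype.card V : ℝ) else 0) =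
      (Fintype.card V : ℝ) ^ 2 / k := by
    intro x
    rw [← sum_filter, sum_const, nsmul_eq_mul, eq_div_iff hk0.ne']
    have : (k : ℝ) * #{x' : V | (σ x').2.1 = (σ x).2.1} = Fintype.card V := by
      exact_mod_cast card_index_eq σ (σ x).2.1
    rw [sq, ← this]
    ring
  rw [sum_congr rfl fun x _ => h2 x, sum_const, card_univ, nsmul_eq_mul]
  ring

theorem increasing_triple_ext {W : Type} [DecidableEq W] {b : W → ℕ} : ∀ {s t : W × W × W},
    (b s.1 < b s.2.1 ∧ b s.2.1 < b s.2.2) → (b t.1 < b t.2.1 ∧ b t.2.1 < b t.2.2) →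
    ({s.1, s.2.1, s.2.2} : Finset W) = {t.1, t.2.1, t.2.2} → s = t := by
  rintro ⟨x, y, z⟩ ⟨x', y', z'⟩ ⟨h1, h2⟩ ⟨h3, h4⟩ h
  simp only at h h1 h2 h3 h4
  have hx : x ∈ ({x', y', z'} : Finset W) := h ▸ (by simp)
  have hy : y ∈ ({x', y', z'} : Finset W) := h ▸ (by simp)
  have hz : z ∈ ({x', y', z'} : Finset W) := h ▸ (by simp)
  simp only [mem_insert, mem_singleton] at hx hy hz
  rcases hx with rfl | rfl | rfl <;> rcases hy with rfl | rfl | rfl <;>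
    rcases hz with rfl | rfl | rfl <;> first | rfl | (exfalso; lia)

theorem choose_three_le [DecidableEq V] (b : V → ℕ) (U : Finset V) :
    (#U).choose 3 ≤ #{t ∈ U ×ˢ U ×ˢ U | b t.1 < b t.2.1 ∧ b t.2.1 < b t.2.2} +
      #{t : V × V × V | b t.1 = b t.2.1} := by
  rw [← card_powersetCard]
  refine le_trans ?_ (card_union_le _ _)
  refine le_trans (card_le_card fun e he => ?_)
    (card_image_le (f := fun t : V × V × V => ({t.1, t.2.1, t.2.2} : Finset V)))
  obtain ⟨heU, hec⟩ := mem_powersetCard.1 he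
  obtain ⟨x, y, z, hxy, hxz, hyz, rfl⟩ := card_eq_three.1 hec
  simp only [insert_subset_iff, singleton_subset_iff] at heU
  obtain ⟨hx, hy, hz⟩ := heU
  simp only [mem_image, mem_union, mem_filter, mem_product, mem_univ, true_and,
    Prod.exists]
  have p1 : ({x, z, y} : Finset V) = {x, y, z} := by ext; simp; tauto
  have p2 : ({y, x, z} : Finset V) = {x, y, z} := by ext; simp; tauto
  have p3 : ({y, z, x} : Finset V) = {x, y, z} := by ext; simp; tauto
  have p4 : ({z, x, y} : Finset V) = {x, y, z} := by ext; simp; tauto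
  have p5 : ({z, y, x} : Finset V) = {x, y, z} := by ext; simp; tauto
  rcases lt_trichotomy (b x) (b y) with h1 | h1 | h1
  · rcases lt_trichotomy (b y) (b z) with h2 | h2 | h2
    · exact ⟨x, y, z, .inl ⟨⟨hx, hy, hz⟩, h1, h2⟩, rfl⟩
    · exact ⟨y, z, x, .inr h2, p3⟩
    · rcases lt_trichotomy (b x) (b z) with h3 | h3 | h3
      · exact ⟨x, z, y, .inl ⟨⟨hx, hz, hy⟩, h3, h2⟩, p1⟩
      · exact ⟨x, z, y, .inr h3, p1⟩
      · exact ⟨z, x, y, .inl ⟨⟨hz, hx, hy⟩, h3, h1⟩, p4⟩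
  · exact ⟨x, y, z, .inr h1, rfl⟩
  · rcases lt_trichotomy (b x) (b z) with h2 | h2 | h2
    · exact ⟨y, x, z, .inl ⟨⟨hy, hx, hz⟩, h1, h2⟩, p2⟩
    · exact ⟨x, z, y, .inr h2, p1⟩
    · rcases lt_trichotomy (b y) (b z) with h3 | h3 | h3
      · exact ⟨y, z, x, .inl ⟨⟨hy, hz, hx⟩, h3, h2⟩, p3⟩
      · exact ⟨y, z, x, .inr h3, p3⟩
      · exact ⟨z, y, x, .inl ⟨⟨hz, hy, hx⟩, h3, h1⟩, p5⟩

theorem card_same_block (σ : V ≃ Fin M × Fin k × (Fin k → Fin 3)) :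
    M * #{t : V × V × V | ((σ t.1).1 : ℕ) = (σ t.2.1).1} = Fintype.card V ^ 3 := by
  have h1 : ∀ x : V, ∑ w : V × V, (if ((σ x).1 : ℕ) = (σ w.1).1 then 1 else 0) =
      Fintype.card V * #{w : V | (σ x).1 = (σ w).1} := by
    intro x
    rw [Fintype.sum_prod_type, sum_comm]
    simp [Fin.val_inj]
  rw [card_filter, Fintype.sum_prod_type, sum_congr rfl fun x _ => h1 x, mul_sum,
    sum_congr rfl fun x _ => (by rw [mul_left_comm, card_block_eq σ] :
      M * (Fintype.card V * #{w : V | (σ x).1 = (σ w).1}) = Fintype.card V * Fintype.card V),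
    sum_const, card_univ, smul_eq_mul]
  ring

theorem sum_indicator_triples [DecidableEq V] (U : Finset V) (R : V → V → V → Prop)
    [∀ x y z, Decidable (R x y z)] (w : V → V → V → ℝ)
    (hw : ∀ x y z, w x y z = if R x y z then 1 else 0) :
    ∑ x, ∑ y, ∑ z, (if x ∈ U then 1 else 0) * (if y ∈ U then 1 else 0) *
      (if z ∈ U then 1 else 0) * w x y z = #{t ∈ U ×ˢ U ×ˢ U | R t.1 t.2.1 t.2.2} := by
  rw [← sum_boole, sum_product, ← sum_subset (subset_univ U)]
  · refine sum_congr rfl fun x hx => ?_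
    rw [sum_product, ← sum_subset (subset_univ U)]
    · refine sum_congr rfl fun y hy => ?_
      rw [← sum_subset (subset_univ U)]
      · exact sum_congr rfl fun z hz => by simp [hx, hy, hz, hw]
      · exact fun z _ hz => by simp [hz]
    · exact fun y _ hy => by simp [hy]
  · exact fun x _ hx => by simp [hx]

/-- A uniformly dense 3-graph whose edges are increasing triples with prescribed pair colours. -/
theorem exists_coloured_dense {η : ℝ} (hη : 0 < η) (n₀ : ℕ) :
    ∃ n : ℕ, n₀ ≤ n ∧ ∃ H : ThreeGraph (Fin n), UniformlyDense H (1 / 27) η ∧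
      ∃ (b : Fin n → ℕ) (κ : Fin n → Fin n → Fin 3), ∀ e ∈ H.edges, ∃ x y z,
        b x < b y ∧ b y < b z ∧ κ x y = 0 ∧ κ x z = 1 ∧ κ y z = 2 ∧ e = {x, y, z} := by
  classical
  obtain ⟨k, hk⟩ := exists_nat_gt (1 / (η / 6) ^ 2)
  obtain ⟨M₀, hM₀⟩ := exists_nat_gt (1 / η)
  have hk0 : (0 : ℝ) < k := lt_trans (by positivity) hk
  have hkN : 0 < k := by exact_mod_cast hk0
  have hM₀0 : (0 : ℝ) < M₀ := lt_trans (by positivity) hM₀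
  set M := max M₀ n₀
  have hM : 1 / η < M := hM₀.trans_le (by exact_mod_cast le_max_left _ _)
  have hM0 : (0 : ℝ) < M := lt_trans (by positivity) hM
  set n := M * (k * 3 ^ k) with hn
  let σ : Fin n ≃ Fin M × Fin k × (Fin k → Fin 3) :=
    (Fintype.equivFinOfCardEq (by simp [hn])).symm
  have hnM : M ≤ n := Nat.le_mul_of_pos_right M (by positivity)
  let b : Fin n → ℕ := fun x => (σ x).1
  let κ := pairColour σ
  let good : Fin n × Fin n × Fin n → Prop := fun t =>
    (b t.1 < b t.2.1 ∧ b t.2.1 < b t.2.2) ∧ κ t.1 t.2.1 = 0 ∧ κ t.1 t.2.2 = 1 ∧ κ t.2.1 t.2.2 = 2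
  let toSet : Fin n × Fin n × Fin n → Finset (Fin n) := fun t => {t.1, t.2.1, t.2.2}
  let H : ThreeGraph (Fin n) :=
    { edges := (univ.filter good).image toSet
      card_eq := by
        intro e he
        obtain ⟨t, ht, rfl⟩ := mem_image.1 he
        obtain ⟨⟨h1, h2⟩, -⟩ := (mem_filter.1 ht).2
        refine card_eq_three.2 ⟨t.1, t.2.1, t.2.2, ?_, ?_, ?_, rfl⟩
        · exact fun h => h1.ne (congrArg b h)
        · exact fun h => (h1.trans h2).ne (congrArg b h)
        · exact fun h => h2.ne (congrArg b h) }
  refine ⟨n, (le_max_right _ _).trans hnM, H, fun U => ?_, b, κ, ?_⟩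
  swap
  · intro e he
    obtain ⟨t, ht, rfl⟩ := mem_image.1 he
    obtain ⟨⟨h1, h2⟩, h3, h4, h5⟩ := (mem_filter.1 ht).2
    exact ⟨t.1, t.2.1, t.2.2, h1, h2, h3, h4, h5, rfl⟩
  have hedges : #{t ∈ U ×ˢ U ×ˢ U | good t} ≤ #{e ∈ H.edges | e ⊆ U} := by
    refine card_le_card_of_injOn toSet (fun t ht => ?_) fun s hs t ht h => ?_
    · obtain ⟨htU, htg⟩ := mem_filter.1 ht
      simp only [mem_product] at htU
      refine mem_filter.2 ⟨mem_image_of_mem _ (mem_filter.2 ⟨mem_univ _, htg⟩), ?_⟩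
      simp [toSet, insert_subset_iff, htU]
    · exact increasing_triple_ext (b := b) (mem_filter.1 hs).2.1 (mem_filter.1 ht).2.1 h
  let u : Fin n → ℝ := fun x => if x ∈ U then 1 else 0
  have hu : ∀ x, 0 ≤ u x ∧ u x ≤ 1 := fun x => by simp only [u]; split_ifs <;> norm_num
  let A : Fin 3 → Fin n → Fin n → ℝ := fun c x y => blockLT σ x y * if κ x y = c then 1 else 0
  have hL : ∀ x y, 0 ≤ blockLT σ x y ∧ blockLT σ x y ≤ 1 := fun x y => by
    unfold blockLT; split_ifs <;> norm_num
  have hA : ∀ c x y, 0 ≤ A c x y ∧ A c x y ≤ 1 := fun c x y => by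
    have := hL x y
    simp only [A]
    split_ifs <;> simp [this]
  have hcut := le_sum_triples_of_cut (A₀ := A 0) (A₁ := A 1) (A₂ := A 2) (L := blockLT σ)
    (ρ := η / 6 * n ^ 2) (hA 1) (hA 2) hL (by
      intro B hB g h hg hh
      obtain ⟨c, rfl⟩ : ∃ c, A c = B := by
        rcases hB with rfl | rfl | rfl
        exacts [⟨0, rfl⟩, ⟨1, rfl⟩, ⟨2, rfl⟩]
      have h1 := colour_cut σ hkN c hg hh
      rw [Fintype.card_fin] at h1
      have h2 : ∀ x y, A c x y - blockLT σ x y / 3 =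
          blockLT σ x y * colourDev c (pairColour σ x y) := by
        intro x y
        simp only [A, colourDev, κ]
        ring
      simp only [h2]
      refine abs_le_of_sq_le_sq (h1.trans ?_) (by positivity)
      rw [div_le_iff₀ hk0]
      rw [div_lt_iff₀ (by positivity)] at hk
      calc (n : ℝ) ^ 4 = n ^ 4 * 1 := (mul_one _).symm
        _ ≤ n ^ 4 * (k * (η / 6) ^ 2) := by gcongr
        _ = _ := by ring) hu
  rw [sum_indicator_triples U (fun x y z => b x < b y ∧ b y < b z) _ (by
      intro x y z
      simp only [blockLT, b, ← Fin.lt_def]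
      by_cases h1 : (σ x).1 < (σ y).1 <;> by_cases h2 : (σ y).1 < (σ z).1
      · simp [h1, h2, h1.trans h2]
      all_goals simp [h1, h2]),
    sum_indicator_triples U (fun x y z => good (x, y, z)) _ (by
      intro x y z
      simp only [A, blockLT, good, b, ← Fin.lt_def]
      by_cases h1 : (σ x).1 < (σ y).1 <;> by_cases h2 : (σ y).1 < (σ z).1
      · simp only [h1, h2, h1.trans h2, if_true, one_mul, true_and]
        by_cases h3 : κ x y = 0 <;> by_cases h4 : κ x z = 1 <;> simp [h3, h4]
      all_goals simp [h1, h2]), Fintype.card_fin] at hcut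
  have h1 : ((#U).choose 3 : ℝ) ≤ #{t ∈ U ×ˢ U ×ˢ U | b t.1 < b t.2.1 ∧ b t.2.1 < b t.2.2} +
      (n : ℝ) ^ 3 / M := by
    have h5 : (M : ℝ) * #{t : Fin n × Fin n × Fin n | b t.1 = b t.2.1} = n ^ 3 := by
      have := card_same_block σ
      rw [Fintype.card_fin] at this
      exact_mod_cast this
    rw [← h5, mul_div_cancel_left₀ _ hM0.ne']
    exact_mod_cast choose_three_le b U
  have h2 : (#{t ∈ U ×ˢ U ×ˢ U | good t} : ℝ) ≤ #{e ∈ H.edges | e ⊆ U} := by exact_mod_cast hedges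
  have h3 : (n : ℝ) ^ 3 / M ≤ η * n ^ 3 := by
    rw [div_le_iff₀ hM0]
    rw [div_lt_iff₀ hη] at hM
    calc (n : ℝ) ^ 3 = 1 * n ^ 3 := (one_mul _).symm
      _ ≤ M * η * n ^ 3 := by gcongr
      _ = _ := by ring
  have h4 : (0 : ℝ) ≤ η * n ^ 3 := by positivity
  have h5 : 3 * (n : ℝ) * (η / 6 * n ^ 2) = η * n ^ 3 / 2 := by ring
  rw [h5] at hcut
  linarith

end Construction

section Order

theorem coloured_triple_cases {V : Type} [DecidableEq V] {b : V → ℕ} {κ : V → V → Fin 3}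
    {p q r : V} (h : ∃ x y z, b x < b y ∧ b y < b z ∧ κ x y = 0 ∧ κ x z = 1 ∧ κ y z = 2 ∧
      ({p, q, r} : Finset V) = {x, y, z}) (hpq : b p ≤ b q) :
    b p < b q ∧ (b q < b r ∧ κ p r = 1 ∧ κ q r = 2 ∨
      b p < b r ∧ b r < b q ∧ κ p r = 0 ∧ κ r q = 2 ∨
      b r < b p ∧ κ r p = 0 ∧ κ r q = 1) := by
  obtain ⟨x, y, z, hxy, hyz, h0, h1, h2, h⟩ := h
  have hx : x ∈ ({p, q, r} : Finset V) := h ▸ (by simp)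
  have hy : y ∈ ({p, q, r} : Finset V) := h ▸ (by simp)
  have hz : z ∈ ({p, q, r} : Finset V) := h ▸ (by simp)
  simp only [mem_insert, mem_singleton] at hx hy hz
  clear h
  rcases hx with rfl | rfl | rfl <;> rcases hy with rfl | rfl | rfl <;>
    rcases hz with rfl | rfl | rfl <;> first | (exfalso; lia) | simp [*, hxy.trans hyz]

theorem coloured_no_path {V : Type} [DecidableEq V] {b : V → ℕ} {κ : V → V → Fin 3}
    {t u v w : V} (h : ∃ x y z, b x < b y ∧ b y < b z ∧ κ x y = 0 ∧ κ x z = 1 ∧ κ y z = 2 ∧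
      ({t, u, w} : Finset V) = {x, y, z})
    (h' : ∃ x y z, b x < b y ∧ b y < b z ∧ κ x y = 0 ∧ κ x z = 1 ∧ κ y z = 2 ∧
      ({u, v, w} : Finset V) = {x, y, z}) (htu : b t < b u) (huv : b u < b v) : False := by
  obtain ⟨-, h1⟩ := coloured_triple_cases h htu.le
  obtain ⟨-, h2⟩ := coloured_triple_cases h' huv.le
  rcases h1 with ⟨h3, -, h4⟩ | ⟨-, h3, -, h4⟩ | ⟨h3, -, h4⟩ <;>
    rcases h2 with ⟨h5, h6, -⟩ | ⟨h5, -, h6, -⟩ | ⟨h5, h6, -⟩ <;>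
    lia

theorem insert_mem_induce {α : Type} [DecidableEq α] {F : ThreeGraph α} {S : Finset α}
    {u v w : α} (h : {u, v, w} ∈ F.edges) (hu : u ∈ S) (hv : v ∈ S) (hw : w ∈ S) :
    {⟨u, hu⟩, ⟨v, hv⟩, ⟨w, hw⟩} ∈ (F.induce S).edges := by
  refine mem_image.2 ⟨{u, v, w}, mem_filter.2 ⟨h, ?_⟩, ?_⟩
  · simp [insert_subset_iff, hu, hv, hw]
  · ext ⟨x, hx⟩
    simp

theorem bddAbove_uniform_set {α : Type} (F : ThreeGraph α) :
    BddAbove {d : ℝ | 0 ≤ d ∧ d ≤ 1 ∧ ∀ η : ℝ, 0 < η → ∀ n₀ : ℕ, ∃ n : ℕ, n₀ ≤ n ∧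
      ∃ H : ThreeGraph (Fin n), ¬ HasCopy H F ∧ UniformlyDense H d η} :=
  ⟨1, fun _ hd => hd.2.1⟩

theorem exists_hasCopy_of_piUnif {α : Type} {F : ThreeGraph α} {d : ℝ} (h : piUnif F < d)
    (h0 : 0 ≤ d) (h1 : d ≤ 1) :
    ∃ η : ℝ, 0 < η ∧ ∃ n₀ : ℕ, ∀ n, n₀ ≤ n → ∀ H : ThreeGraph (Fin n), UniformlyDense H d η →
      HasCopy H F := by
  by_contra! hcon
  refine h.not_ge (le_csSup (bddAbove_uniform_set F) ⟨h0, h1, fun η hη n₀ => ?_⟩)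
  obtain ⟨n, hn, H, hH, hc⟩ := hcon η hη n₀
  exact ⟨n, hn, H, hc, hH⟩

/-- Vanishing uniform density orders the vertices so that no link contains a monotone path. -/
theorem exists_order_of_piUnif {α : Type} [DecidableEq α] {F : ThreeGraph α} {S : Finset α}
    (h : piUnif (F.induce S) = 0) :
    ∃ g : α → ℕ, (∀ u ∈ S, ∀ v ∈ S, ∀ w ∈ S, {u, v, w} ∈ F.edges → g u ≠ g v) ∧
      ∀ t ∈ S, ∀ u ∈ S, ∀ v ∈ S, ∀ w ∈ S, {t, u, w} ∈ F.edges → {u, v, w} ∈ F.edges →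
        g t < g u → g u < g v → False := by
  obtain ⟨η, hη, n₀, hcopy⟩ := exists_hasCopy_of_piUnif (d := 1 / 27) (h.trans_lt (by norm_num))
    (by norm_num) (by norm_num)
  obtain ⟨n, hn, H, hH, b, κ, hb⟩ := exists_coloured_dense hη n₀
  obtain ⟨φ, -, hφ⟩ := hcopy n hn H hH
  have hedge : ∀ {u v w : α}, {u, v, w} ∈ F.edges → ∀ (hu : u ∈ S) (hv : v ∈ S) (hw : w ∈ S),
      ∃ x y z, b x < b y ∧ b y < b z ∧ κ x y = 0 ∧ κ x z = 1 ∧ κ y z = 2 ∧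
        ({φ ⟨u, hu⟩, φ ⟨v, hv⟩, φ ⟨w, hw⟩} : Finset (Fin n)) = {x, y, z} := by
    intro u v w he hu hv hw
    refine hb _ ?_
    have := hφ _ (insert_mem_induce he hu hv hw)
    rwa [image_insert, image_insert, image_singleton] at this
  refine ⟨fun x => if hx : x ∈ S then b (φ ⟨x, hx⟩) else 0, ?_, ?_⟩
  · intro u hu v hv w hw he
    simp only [hu, hv, dif_pos]
    exact fun hg => (coloured_triple_cases (hedge he hu hv hw) hg.le).1.ne hg
  · intro t ht u hu v hv w hw he he'
    simp only [ht, hu, hv, dif_pos]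
    exact coloured_no_path (hedge he ht hu hw) (hedge he' hu hv hw)

end Order

theorem exists_sorting {α : Type} [Fintype α] {β : Type} [LinearOrder β] {ℓ : α → β}
    (hℓ : Function.Injective ℓ) : ∃ pos : Fin (Fintype.card α) ≃ α, StrictMono (ℓ ∘ pos) := by
  let _ : LinearOrder α := LinearOrder.lift' ℓ hℓ
  let pos := monoEquivOfFin α rfl
  exact ⟨pos.toEquiv, fun i j hij => pos.strictMono hij⟩

section Layered

variable {α : Type} [DecidableEq α]

theorem ne_of_card_eq_three {u v w : α} (h : #{u, v, w} = 3) : u ≠ v ∧ u ≠ w ∧ v ≠ w := by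
  refine ⟨?_, ?_, ?_⟩ <;> rintro rfl <;> revert h
  · rw [insert_idem]
    exact (card_le_two.trans_lt (by norm_num)).ne
  · rw [insert_comm, pair_eq_singleton]
    exact (card_le_two.trans_lt (by norm_num)).ne
  · rw [pair_eq_singleton]
    exact (card_le_two.trans_lt (by norm_num)).ne

theorem exists_third {e : Finset α} (he : #e = 3) {u v : α} (hu : u ∈ e) (hv : v ∈ e)
    (huv : u ≠ v) : ∃ w, u ≠ w ∧ v ≠ w ∧ e = {u, v, w} := by
  obtain ⟨x, y, z, hxy, hxz, hyz, rfl⟩ := card_eq_three.1 he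
  simp only [mem_insert, mem_singleton] at hu hv
  rcases hu with rfl | rfl | rfl <;> rcases hv with rfl | rfl | rfl
  · exact absurd rfl huv
  · exact ⟨z, hxz, hyz, rfl⟩
  · exact ⟨y, hxy, hyz.symm, by ext; simp; tauto⟩
  · exact ⟨z, hyz, hxz, by ext; simp; tauto⟩
  · exact absurd rfl huv
  · exact ⟨x, hxy.symm, hxz.symm, by ext; simp; tauto⟩
  · exact ⟨y, hyz.symm, hxy, by ext; simp; tauto⟩
  · exact ⟨x, hxz.symm, hxy.symm, by ext; simp; tauto⟩
  · exact absurd rfl huv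

theorem IsLayeredFunction.sup_eq {E : Finset (Finset α)} {f : α → ℕ} (hf : IsLayeredFunction E f)
    (hE : ∀ e ∈ E, #e = 3) {e e' : Finset α} (he : e ∈ E) (he' : e' ∈ E) {u v u' v' : α}
    (hu : u ∈ e) (hv : v ∈ e) (huv : u ≠ v) (hu' : u' ∈ e') (hv' : v' ∈ e') (huv' : u' ≠ v')
    (h₁ : f u = f u') (h₂ : f v = f v') : e.sup f = e'.sup f := by
  obtain ⟨w, huw, hvw, rfl⟩ := exists_third (hE e he) hu hv huv
  obtain ⟨w', huw', hvw', rfl⟩ := exists_third (hE e' he') hu' hv' huv'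
  have := hf.2.2 _ he _ he' u v w u' v' w' huv huw hvw huv' huw' hvw' rfl rfl h₁ h₂
  simp only [sup_insert, sup_singleton, h₁, h₂, this]

theorem IsLayeredFunction.exists_mem {E : Finset (Finset α)} {f : α → ℕ}
    (hf : IsLayeredFunction E f) {e e' : Finset α} (he : e ∈ E) (he' : e' ∈ E)
    (h : e.sup f = e'.sup f) {u : α} (hu : u ∈ e) : ∃ u' ∈ e', f u' = f u := by
  have h1 : f u ∈ Multiset.map f e'.val := hf.2.1 e he e' he' h ▸ Multiset.mem_map_of_mem f hu
  exact Multiset.mem_map.1 h1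

/-- The edge classes of a layered 3-graph can be ranked so that an edge meets the span of every
class of at least the same rank in at most one vertex. -/
theorem IsLayeredFunction.exists_key [Fintype α] {E : Finset (Finset α)} {f : α → ℕ}
    (hf : IsLayeredFunction E f) (hE : ∀ e ∈ E, #e = 3) :
    ∃ key : ℕ → ℕ, ∀ c c', c ≠ c' → key c' ≤ key c → ∀ e ∈ E, e.sup f = c' → ∀ u ∈ e, ∀ v ∈ e,
      ∀ e₁ ∈ E, ∀ e₂ ∈ E, e₁.sup f = c → e₂.sup f = c → u ∈ e₁ → v ∈ e₂ → u = v := by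
  classical
  refine ⟨fun c => if ∃ e ∈ E, e.sup f = c ∧ ∃ p ∈ e, ∃ q ∈ e, p ≠ q ∧ f p = f q then
    c + (univ.sup f + 1) else c, ?_⟩
  intro c c' hcc hkey e he hec u hu v hv e₁ he₁ e₂ he₂ hec₁ hec₂ hu₁ hv₂
  by_contra huv
  by_cases hfuv : f u = f v
  · simp only at hkey
    rw [if_pos ⟨e, he, hec, u, hu, v, hv, huv, hfuv⟩] at hkey
    have hle : ∀ e : Finset α, e.sup f ≤ univ.sup f := fun e => sup_mono (subset_univ e)
    split_ifs at hkey with hd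
    · obtain ⟨e₀, he₀, hec₀, p, hp, q, hq, hpq, hfpq⟩ := hd
      obtain ⟨u', hu', hfu'⟩ := hf.exists_mem he₁ he₀ (hec₁.trans hec₀.symm) hu₁
      by_cases hup : f u' = f p
      · refine hcc ?_
        rw [← hec, ← hec₀]
        exact (hf.sup_eq hE he he₀ hu hv huv hp hq hpq (hfu'.symm.trans hup)
          (hfuv.symm.trans (hfu'.symm.trans (hup.trans hfpq)))).symm
      · obtain ⟨w, hw, hwt⟩ := hf.1 e₀ he₀
        have hwu : w = u' := by
          obtain ⟨r, hpr, hqr, rfl⟩ := exists_third (hE e₀ he₀) hp hq hpq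
          have hwp : w ≠ p := fun h => (hwt q hq (h ▸ hpq.symm)).ne (h ▸ hfpq.symm)
          have hwq : w ≠ q := fun h => (hwt p hp (h ▸ hpq)).ne (h ▸ hfpq)
          have hup' : u' ≠ p := fun h => hup (h ▸ rfl)
          have huq' : u' ≠ q := fun h => hup (h ▸ hfpq.symm)
          simp only [mem_insert, mem_singleton, hwp, hwq, hup', huq', false_or] at hw hu'
          rw [hw, hu']
        subst hwu
        have h1 : e₀.sup f ≤ f w := Finset.sup_le fun x hx => by
          by_cases hxw : x = w
          · rw [hxw]
          · exact (hwt x hx hxw).le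
        have h2 : f u ≤ e.sup f := le_sup hu
        lia
    · have := hle e₁
      lia
  · obtain ⟨v', hv', hfv'⟩ := hf.exists_mem he₂ he₁ (hec₂.trans hec₁.symm) hv₂
    refine hcc ?_
    rw [← hec, ← hec₁]
    exact (hf.sup_eq hE he he₁ hu hv huv hu₁ hv' (fun h => hfuv (h ▸ hfv')) rfl hfv'.symm).symm

theorem IsLayeredFunction.exists_layer_order [Fintype α] {F : ThreeGraph α} {f : α → ℕ}
    (hf : IsLayeredFunction F.edges f)
    (h : ∀ a b : ℕ, a ∈ univ.image f → b ∈ univ.image f → a ≠ b →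
      (∃ e ∈ F.edges, e ⊆ univ.filter fun x => f x = a ∨ f x = b) →
      piUnif (F.induce (univ.filter fun x => f x = a ∨ f x = b)) = 0) (a : ℕ) :
    ∃ g : α → ℕ, (∀ u v w, f u = a → f v = a → f w ≠ a → {u, v, w} ∈ F.edges → g u ≠ g v) ∧
      ∀ t u v w, f t = a → f u = a → f v = a → f w ≠ a → {t, u, w} ∈ F.edges →
        {u, v, w} ∈ F.edges → g t < g u → g u < g v → False := by
  by_cases hex : ∃ u v w, f u = a ∧ f v = a ∧ f w ≠ a ∧ {u, v, w} ∈ F.edges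
  · obtain ⟨u₀, v₀, w₀, hu₀, hv₀, hw₀, he₀⟩ := hex
    have huniq : ∀ {u v w}, f u = a → f v = a → {u, v, w} ∈ F.edges → f w = f w₀ := by
      intro u v w hu hv he
      have h1 := ne_of_card_eq_three (F.card_eq _ he)
      have h2 := ne_of_card_eq_three (F.card_eq _ he₀)
      exact hf.2.2 _ he _ he₀ u v w u₀ v₀ w₀ h1.1 h1.2.1 h1.2.2 h2.1 h2.2.1 h2.2.2 rfl rfl
        (hu.trans hu₀.symm) (hv.trans hv₀.symm)
    obtain ⟨g, hg₁, hg₂⟩ := exists_order_of_piUnif (h a (f w₀)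
      (mem_image.2 ⟨u₀, mem_univ _, hu₀⟩) (mem_image_of_mem f (mem_univ _)) hw₀.symm
      ⟨_, he₀, by simp [insert_subset_iff, hu₀, hv₀]⟩)
    refine ⟨g, ?_, ?_⟩
    · intro u v w hu hv _ he
      exact hg₁ u (by simp [hu]) v (by simp [hv]) w (by simp [huniq hu hv he]) he
    · intro t u v w ht hu hv _ he he'
      exact hg₂ t (by simp [ht]) u (by simp [hu]) v (by simp [hv]) w
        (by simp [huniq hu hv he']) he he'
  · refine ⟨fun _ => 0, fun u v w hu hv hw he => ?_, fun t u v w _ _ _ _ _ _ h => ?_⟩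
    · exact absurd ⟨u, v, w, hu, hv, hw, he⟩ hex
    · exact absurd h (lt_irrefl _)

end Layered

theorem exists_sorted_triple {p : ℕ} {e : Finset (Fin p)} (he : #e = 3) :
    ∃ u v w, u < v ∧ v < w ∧ e = {u, v, w} := by
  let s := e.orderEmbOfFin he
  refine ⟨s 0, s 1, s 2, s.strictMono (by decide), s.strictMono (by decide), ?_⟩
  have h : univ.image s = e := image_orderEmbOfFin_univ e he
  rw [← h, (by decide : (univ : Finset (Fin 3)) = {0, 1, 2}), image_insert, image_insert,
    image_singleton]

/-- An ordering of the vertices of a layered 3-graph for which every link is free of monotone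
paths, given such an ordering of each layer. -/
theorem IsLayeredFunction.exists_position {α : Type} [Fintype α] [DecidableEq α]
    {F : ThreeGraph α} {f : α → ℕ} (hf : IsLayeredFunction F.edges f) {g : ℕ → α → ℕ}
    (hg : ∀ a u v w, f u = a → f v = a → f w ≠ a → {u, v, w} ∈ F.edges → g a u ≠ g a v)
    (hpath : ∀ a t u v w, f t = a → f u = a → f v = a → f w ≠ a → {t, u, w} ∈ F.edges →
        {u, v, w} ∈ F.edges → g a t < g a u → g a u < g a v → False) :
    ∃ pos : Fin (Fintype.card α) ≃ α, Monotone (f ∘ pos) ∧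
      (∀ u v w, u < v → v < w → {pos u, pos v, pos w} ∈ F.edges → f (pos v) < f (pos w)) ∧
      ∀ t u v w, t < u → u < v → v < w → {pos t, pos u, pos w} ∈ F.edges →
        {pos u, pos v, pos w} ∉ F.edges := by
  let ℓ : α → ℕ ×ₗ ℕ ×ₗ Fin (Fintype.card α) := fun x =>
    toLex (f x, toLex (g (f x) x, Fintype.equivFin α x))
  have hℓ : Function.Injective ℓ := fun x y hxy => by
    simp only [ℓ, EmbeddingLike.apply_eq_iff_eq, Prod.mk.injEq] at hxy
    exact hxy.2.2
  obtain ⟨pos, hpos⟩ := exists_sorting hℓ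
  have hlex : ∀ {i j}, i < j → f (pos i) < f (pos j) ∨ f (pos i) = f (pos j) ∧
      g (f (pos i)) (pos i) ≤ g (f (pos i)) (pos j) := by
    intro i j hij
    have h1 := hpos hij
    simp only [Function.comp, ℓ, Prod.Lex.toLex_lt_toLex] at h1
    rcases h1 with h1 | ⟨h1, h2⟩
    · exact .inl h1
    · refine .inr ⟨h1, ?_⟩
      rw [← h1] at h2
      rcases h2 with h2 | ⟨h2, -⟩
      exacts [h2.le, h2.le]
  have hmono : Monotone (f ∘ pos) := monotone_iff_forall_lt.2 fun i j hij =>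
    (hlex hij).elim le_of_lt fun h => h.1.le
  have htop : ∀ u v w, u < v → v < w → {pos u, pos v, pos w} ∈ F.edges →
      f (pos v) < f (pos w) := by
    intro u v w huv hvw he
    obtain ⟨x, hx, hxt⟩ := hf.1 _ he
    have h1 : f (pos u) ≤ f (pos v) := hmono huv.le
    have h2 : f (pos v) ≤ f (pos w) := hmono hvw.le
    have huv' := pos.injective.ne huv.ne
    have hvw' := pos.injective.ne hvw.ne
    simp only [mem_insert, mem_singleton] at hx
    rcases hx with rfl | rfl | rfl
    · exact absurd (hxt (pos v) (by simp) huv'.symm) h1.not_gt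
    · exact absurd (hxt (pos w) (by simp) hvw'.symm) h2.not_gt
    · exact hxt (pos v) (by simp) hvw'
  refine ⟨pos, hmono, htop, ?_⟩
  intro t u v w htu huv hvw he he'
  have h1 : f (pos t) ≤ f (pos u) := hmono htu.le
  have h2 : f (pos u) ≤ f (pos v) := hmono huv.le
  have h3 := htop u v w huv hvw he'
  have hsup : ({pos t, pos u, pos w} : Finset α).sup f =
      ({pos u, pos v, pos w} : Finset α).sup f := by
    simp only [sup_insert, sup_singleton]
    lia
  have hval : ∀ {x y z : α}, #{x, y, z} = 3 →
      Multiset.map f ({x, y, z} : Finset α).val = {f x, f y, f z} := by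
    intro x y z hc
    obtain ⟨hxy, hxz, hyz⟩ := ne_of_card_eq_three hc
    rw [insert_val_of_notMem (by simp [hxy, hxz]), insert_val_of_notMem (by simp [hyz])]
    simp
  have hm := hf.2.1 _ he _ he' hsup
  rw [hval (F.card_eq _ he), hval (F.card_eq _ he')] at hm
  have hsum := congrArg Multiset.sum hm
  simp only [Multiset.insert_eq_cons, Multiset.sum_cons, Multiset.sum_singleton] at hsum
  have ht : f (pos t) = f (pos u) := by lia
  have hv : f (pos v) = f (pos u) := by lia
  have hw : f (pos w) ≠ f (pos u) := by lia
  refine hpath _ _ _ _ _ ht rfl hv hw he he' ?_ ?_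
  · refine lt_of_le_of_ne ?_ (hg _ _ _ _ ht rfl hw he)
    have := hlex htu
    rw [ht] at this
    exact (this.resolve_left (lt_irrefl _)).2
  · refine lt_of_le_of_ne ?_ (hg _ _ _ _ rfl hv hw he')
    have := hlex huv
    rw [hv] at this
    exact (this.resolve_left (lt_irrefl _)).2

theorem piUnif_eq_zero_of_forall {α : Type} {F : ThreeGraph α}
    (h : ∀ d : ℝ, 0 < d → ∃ η : ℝ, 0 < η ∧ ∃ n₀ : ℕ, ∀ (n : ℕ) (H : ThreeGraph (Fin n)), n₀ ≤ n →
      UniformlyDense H d η → HasCopy H F) : piUnif F = 0 := by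
  refine le_antisymm (Real.sSup_nonpos fun d hd => ?_) (Real.sSup_nonneg fun d hd => hd.1)
  by_contra! hd0
  obtain ⟨η, hη, n₀, hcopy⟩ := h d hd0
  obtain ⟨n, hn, H, hH, hdense⟩ := hd.2.2 η hη n₀
  exact hH (hcopy n H hn hdense)

theorem HasCopy.induce {α β : Type} [DecidableEq α] [DecidableEq β] {H : ThreeGraph β}
    {F : ThreeGraph α} (h : HasCopy H F) (S : Finset α) : HasCopy H (F.induce S) := by
  obtain ⟨φ, hφ, hedge⟩ := h
  refine ⟨fun x => φ x.1, fun x y hxy => Subtype.ext (hφ hxy), fun e he => ?_⟩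
  obtain ⟨e', he', rfl⟩ := mem_image.1 he
  obtain ⟨heF, heS⟩ := mem_filter.1 he'
  convert hedge e' heF using 1
  ext y
  simp only [mem_image, mem_subtype, Subtype.exists]
  exact ⟨fun ⟨x, _, hx, hy⟩ => ⟨x, hx, hy⟩, fun ⟨x, hx, hy⟩ => ⟨x, heS hx, hx, hy⟩⟩

theorem piUnif_induce_eq_zero {α : Type} [DecidableEq α] {F : ThreeGraph α} (h : piUnif F = 0)
    (S : Finset α) : piUnif (F.induce S) = 0 := by
  refine le_antisymm (Real.sSup_nonpos fun d hd => ?_) (Real.sSup_nonneg fun d hd => hd.1)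
  rw [← h]
  refine le_csSup (bddAbove_uniform_set F) ⟨hd.1, hd.2.1, fun η hη n₀ => ?_⟩
  obtain ⟨n, hn, H, hH, hdense⟩ := hd.2.2 η hη n₀
  exact ⟨n, hn, H, fun hc => hH (hc.induce S), hdense⟩

theorem IsLayeredFunction.piUnif_eq_zero {α : Type} [Fintype α] [DecidableEq α]
    {F : ThreeGraph α} {f : α → ℕ} (hf : IsLayeredFunction F.edges f)
    (h : ∀ a b : ℕ, a ∈ univ.image f → b ∈ univ.image f → a ≠ b →
      (∃ e ∈ F.edges, e ⊆ univ.filter fun x => f x = a ∨ f x = b) →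
      piUnif (F.induce (univ.filter fun x => f x = a ∨ f x = b)) = 0) : piUnif F = 0 := by
  choose g hg hpath using hf.exists_layer_order h
  obtain ⟨pos, hmono, htop, hno⟩ := hf.exists_position hg hpath
  obtain ⟨key, hkey⟩ := hf.exists_key F.card_eq
  let E : Finset (Finset (Fin (Fintype.card α))) := {e | e.image pos ∈ F.edges}
  have hE : ∀ {e}, e ∈ E ↔ e.image pos ∈ F.edges := by simp [E]
  have himg : ∀ u v w, ({u, v, w} : Finset (Fin (Fintype.card α))).image pos =
      {pos u, pos v, pos w} := by simp [image_insert]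
  have hsup : ∀ e : Finset (Fin (Fintype.card α)), (e.image pos).sup f = e.sup (f ∘ pos) :=
    fun e => sup_image e pos f
  refine piUnif_eq_zero_of_forall fun d hd => ?_
  obtain ⟨η, hη, n₀, hcopy⟩ := exists_copy_of_ordered E (f ∘ pos) hmono (fun e he => by
      rw [hE] at he
      obtain ⟨u, v, w, huv, hvw, rfl⟩ := exists_sorted_triple
        ((card_image_of_injective e pos.injective).symm.trans (F.card_eq _ he))
      exact ⟨u, v, w, huv, hvw, htop u v w huv hvw (himg u v w ▸ he), rfl⟩)
    (fun t u v w htu huv hvw he => by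
      rw [hE, himg] at he ⊢
      exact hno t u v w htu huv hvw he) key
    (fun c c' hcc hle e he hec u hu v hv e₁ he₁ e₂ he₂ hec₁ hec₂ hu₁ hv₂ => by
      rw [hE] at he he₁ he₂
      rw [← hsup] at hec hec₁ hec₂
      exact pos.injective (hkey c c' hcc hle _ he hec _ (mem_image_of_mem _ hu) _
        (mem_image_of_mem _ hv) _ he₁ _ he₂ hec₁ hec₂ (mem_image_of_mem _ hu₁)
        (mem_image_of_mem _ hv₂))) hd
  refine ⟨η, hη, n₀, fun n H hn hdense => ?_⟩
  obtain ⟨φ, hφ, hedge⟩ := hcopy n H hn hdense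
  refine ⟨φ ∘ pos.symm, hφ.comp pos.symm.injective, fun e he => ?_⟩
  have := hedge (e.image pos.symm) (by
    rw [hE, image_image, Equiv.self_comp_symm, image_id]
    exact he)
  rwa [image_image] at this

/-- For a layered 3-graph `F` with layered function `f` (layers being the preimages of the
values `a` in the range of `f`), `π_⸫(F) = 0` iff `π_⸫(F_{i,j}) = 0` for every linked pair
of layers, i.e. every pair of distinct values `a, b` in the range of `f` such that the
subhypergraph induced on the union of the corresponding two layers has an edge. -/
theorem stmt11 {α : Type} [Fintype α] [DecidableEq α] (F : ThreeGraph α) (f : α → ℕ)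
    (hf : IsLayeredFunction F.edges f) :
    piUnif F = 0 ↔
      ∀ a b : ℕ, a ∈ Finset.univ.image f → b ∈ Finset.univ.image f → a ≠ b →
        (∃ e ∈ F.edges, e ⊆ Finset.univ.filter (fun x => f x = a ∨ f x = b)) →
        piUnif (F.induce (Finset.univ.filter (fun x => f x = a ∨ f x = b))) = 0 := by
  exact ⟨fun h a b _ _ _ _ => piUnif_induce_eq_zero h _, hf.piUnif_eq_zero⟩
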